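/- arXiv:2103.08270 — 9 statements merged into one kernel-verified Lean document; each statement's English description precedes it below -/
import Mathlib

section
/- Let E be a real inner product space and let φ : E → ℝ be differentiable, ℓ-smooth and μ-strongly convex with 0 < μ ≤ ℓ. Then for all x₁, x₂ ∈ E: ⟨∇φ(x₁) − ∇φ(x₂), x₁ − x₂⟩ ≥ (ℓμ/(ℓ+μ))·‖x₁ − x₂‖² + (1/(ℓ+μ))·‖∇φ(x₁) − ∇φ(x₂)‖². -/
open scoped RealInnerProductSpace

/-- Descent lemma: the quadratic upper bound for a function with `ℓ`-Lipschitz gradient. -/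
theorem descent_of_lipschitz_gradient {E : Type*} [NormedAddCommGroup E] [InnerProductSpace ℝ E]
    {φ : E → ℝ} {φ' : E → E} {ℓ : ℝ}
    (hdiff : ∀ x, HasFDerivAt φ (InnerProductSpace.toDualMap ℝ E (φ' x)) x)
    (hsmooth : ∀ x y : E, ‖φ' x - φ' y‖ ≤ ℓ * ‖x - y‖) (x v : E) :
    φ (x + v) ≤ φ x + ⟪φ' x, v⟫ + ℓ / 2 * ‖v‖ ^ 2 := by
  have hline (t : ℝ) : HasDerivAt (fun s : ℝ => x + s • v) v t := by
    simpa using ((hasDerivAt_id t).smul_const v).const_add x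
  have hderiv (t : ℝ) : HasDerivAt
      (fun s : ℝ => φ (x + s • v) - s * ⟪φ' x, v⟫ - s ^ 2 * (ℓ / 2 * ‖v‖ ^ 2))
      (⟪φ' (x + t • v), v⟫ - ⟪φ' x, v⟫ - 2 * t * (ℓ / 2 * ‖v‖ ^ 2)) t := by
    have h₁ := (hdiff (x + t • v)).comp_hasDerivAt t (hline t)
    have h₂ := (hasDerivAt_id t).mul_const ⟪φ' x, v⟫
    have h₃ := (hasDerivAt_pow 2 t).mul_const (ℓ / 2 * ‖v‖ ^ 2)
    exact ((h₁.sub h₂).sub h₃).congr_deriv (by simp)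
  have hanti : AntitoneOn
      (fun s : ℝ => φ (x + s • v) - s * ⟪φ' x, v⟫ - s ^ 2 * (ℓ / 2 * ‖v‖ ^ 2))
      (Set.Icc 0 1) := by
    refine antitoneOn_of_hasDerivWithinAt_nonpos (convex_Icc 0 1)
      (fun t _ => (hderiv t).continuousAt.continuousWithinAt)
      (fun t _ => (hderiv t).hasDerivWithinAt) fun t ht => ?_
    rw [interior_Icc] at ht
    have h₁ := real_inner_le_norm (φ' (x + t • v) - φ' x) v
    have h₂ := hsmooth (x + t • v) x
    rw [add_sub_cancel_left, norm_smul, Real.norm_of_nonneg ht.1.le] at h₂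
    have h₃ := mul_le_mul_of_nonneg_right h₂ (norm_nonneg v)
    rw [inner_sub_left] at h₁
    linarith
  have h := hanti (Set.left_mem_Icc.2 zero_le_one) (Set.right_mem_Icc.2 zero_le_one) zero_le_one
  simp only [one_smul, zero_smul, add_zero] at h
  linarith

/-- The strong-convexity lower bound, improved by the co-coercivity term of the convex function
`φ - μ / 2 * ‖·‖ ^ 2`, whose gradient is `(ℓ - μ)`-Lipschitz. -/
theorem strongConvex_lower_bound_of_lipschitz_gradient {E : Type*} [NormedAddCommGroup E]
    [InnerProductSpace ℝ E] {φ : E → ℝ} {φ' : E → E} {ℓ μ : ℝ} (hμℓ : μ < ℓ)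
    (hdiff : ∀ x, HasFDerivAt φ (InnerProductSpace.toDualMap ℝ E (φ' x)) x)
    (hsmooth : ∀ x y : E, ‖φ' x - φ' y‖ ≤ ℓ * ‖x - y‖)
    (hsc : ∀ x y : E, φ y ≥ φ x + ⟪φ' x, y - x⟫ + μ / 2 * ‖y - x‖ ^ 2) (x y : E) :
    φ x + ⟪φ' x, y - x⟫ + μ / 2 * ‖y - x‖ ^ 2
      + ‖φ' y - φ' x - μ • (y - x)‖ ^ 2 / (2 * (ℓ - μ)) ≤ φ y := by
  have hM : 0 < ℓ - μ := sub_pos.2 hμℓ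
  obtain ⟨d, rfl⟩ : ∃ d, y = x + d := ⟨y - x, by abel⟩
  obtain ⟨r, hr⟩ : ∃ r, r = φ' (x + d) - φ' x - μ • d := ⟨_, rfl⟩
  have hg : φ' (x + d) = φ' x + μ • d + r := by rw [hr]; abel
  have hup := descent_of_lipschitz_gradient hdiff hsmooth (x + d) (-(ℓ - μ)⁻¹ • r)
  have hlow := hsc x (x + d + -(ℓ - μ)⁻¹ • r)
  rw [add_assoc, add_sub_cancel_left, ← add_assoc, norm_add_sq_real] at hlow
  rw [add_sub_cancel_left, ← hr]
  simp only [hg, inner_add_left, inner_add_right, real_inner_smul_left, real_inner_smul_right,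
    norm_smul, mul_pow, Real.norm_eq_abs, sq_abs, real_inner_self_eq_norm_sq] at hup hlow
  have hquad : ‖r‖ ^ 2 / (2 * (ℓ - μ)) =
      (ℓ - μ)⁻¹ * ‖r‖ ^ 2 - (ℓ - μ) / 2 * ((-(ℓ - μ)⁻¹) ^ 2 * ‖r‖ ^ 2) := by
    field_simp
    ring
  rw [hquad]
  linarith

/-- Lemma 1 of the paper.
If `φ : E → ℝ` is differentiable with gradient `φ'`, `ℓ`-smooth and `μ`-strongly convex
with `0 < μ ≤ ℓ`, then for all `x₁ x₂`,
`⟪∇φ(x₁) − ∇φ(x₂), x₁ − x₂⟫ ≥ (ℓμ/(ℓ+μ))‖x₁ − x₂‖² + (1/(ℓ+μ))‖∇φ(x₁) − ∇φ(x₂)‖²`. -/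
theorem stmt_0 {E : Type*} [NormedAddCommGroup E] [InnerProductSpace ℝ E]
    (φ : E → ℝ) (φ' : E → E) (ℓ μ : ℝ) (hμ : 0 < μ) (hμℓ : μ ≤ ℓ)
    (hdiff : ∀ x, HasFDerivAt φ (InnerProductSpace.toDualMap ℝ E (φ' x)) x)
    (hsmooth : ∀ x₁ x₂ : E, ‖φ' x₁ - φ' x₂‖ ≤ ℓ * ‖x₁ - x₂‖)
    (hsc : ∀ x₁ x₂ : E, φ x₂ ≥ φ x₁ + ⟪φ' x₁, x₂ - x₁⟫ + μ / 2 * ‖x₂ - x₁‖ ^ 2)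
    (x₁ x₂ : E) :
    ⟪φ' x₁ - φ' x₂, x₁ - x₂⟫ ≥
      ℓ * μ / (ℓ + μ) * ‖x₁ - x₂‖ ^ 2 + 1 / (ℓ + μ) * ‖φ' x₁ - φ' x₂‖ ^ 2 := by
  have hpos : 0 < ℓ + μ := by linarith
  suffices h : ℓ * μ * ‖x₁ - x₂‖ ^ 2 + ‖φ' x₁ - φ' x₂‖ ^ 2
      ≤ (ℓ + μ) * ⟪φ' x₁ - φ' x₂, x₁ - x₂⟫ by
    rw [ge_iff_le, div_mul_eq_mul_div, div_mul_eq_mul_div, one_mul, ← add_div, div_le_iff₀' hpos]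
    exact h
  have hswap : ⟪φ' x₁, x₂ - x₁⟫ = -⟪φ' x₁, x₁ - x₂⟫ := by rw [← inner_neg_right, neg_sub]
  rcases hμℓ.eq_or_lt with rfl | hlt
  · have h₁ := hsc x₁ x₂
    have h₂ := hsc x₂ x₁
    rw [hswap, norm_sub_rev x₂ x₁] at h₁
    have hmono : μ * ‖x₁ - x₂‖ ^ 2 ≤ ⟪φ' x₁ - φ' x₂, x₁ - x₂⟫ := by
      rw [inner_sub_left]
      linarith
    have hsq := pow_le_pow_left₀ (norm_nonneg _) (hsmooth x₁ x₂) 2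
    have hmul := mul_le_mul_of_nonneg_left hmono hμ.le
    linarith
  · have h₁ := strongConvex_lower_bound_of_lipschitz_gradient hlt hdiff hsmooth hsc x₁ x₂
    have h₂ := strongConvex_lower_bound_of_lipschitz_gradient hlt hdiff hsmooth hsc x₂ x₁
    have hrev : ‖φ' x₂ - φ' x₁ - μ • (x₂ - x₁)‖ = ‖φ' x₁ - φ' x₂ - μ • (x₁ - x₂)‖ := by
      rw [← norm_neg]
      congr 1
      module
    rw [hswap, norm_sub_rev x₂ x₁, hrev] at h₁
    have hM : 0 < ℓ - μ := sub_pos.2 hlt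
    have hsum : ‖φ' x₁ - φ' x₂ - μ • (x₁ - x₂)‖ ^ 2 / (ℓ - μ)
        ≤ ⟪φ' x₁ - φ' x₂, x₁ - x₂⟫ - μ * ‖x₁ - x₂‖ ^ 2 := by
      rw [mul_comm 2 (ℓ - μ), ← div_div] at h₁ h₂
      rw [inner_sub_left]
      linarith
    rw [div_le_iff₀ hM, norm_sub_sq_real, real_inner_smul_right, norm_smul, mul_pow,
      Real.norm_eq_abs, sq_abs] at hsum
    linarith
end

section
/- Let E be a real inner product space and let φ : E → ℝ be convex and differentiable, and suppose that for some ℓ > 0 and all x₁, x₂ ∈ E one has φ(x₂) − φ(x₁) − ⟨∇φ(x₁), x₂ − x₁⟩ ≤ (ℓ/2)‖x₁ − x₂‖². Then for all x₁, x₂ ∈ E: ⟨∇φ(x₁) − ∇φ(x₂), x₁ − x₂⟩ ≥ (1/ℓ)‖∇φ(x₁) − ∇φ(x₂)‖² (cocoercivity of the gradient). -/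
open scoped RealInnerProductSpace

/-- The first-order characterisation of convexity: the graph lies above its tangent planes. -/
theorem ConvexOn.add_fderiv_sub_le {E : Type*} [NormedAddCommGroup E] [NormedSpace ℝ E]
    {φ : E → ℝ} {L : E →L[ℝ] ℝ} {x : E} (hconv : ConvexOn ℝ Set.univ φ)
    (hL : HasFDerivAt φ L x) (y : E) : φ x + L (y - x) ≤ φ y := by
  have hline : HasDerivAt (AffineMap.lineMap x y : ℝ → E) (y - x) 0 :=
    AffineMap.hasDerivAt_lineMap
  have hderiv : HasDerivAt (φ ∘ (AffineMap.lineMap x y : ℝ → E)) (L (y - x)) 0 :=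
    HasFDerivAt.comp_hasDerivAt (0 : ℝ) (by simpa using hL) hline
  have hcomp : ConvexOn ℝ Set.univ (φ ∘ (AffineMap.lineMap x y : ℝ → E)) := by
    simpa using hconv.comp_affineMap (AffineMap.lineMap x y : ℝ →ᵃ[ℝ] E)
  have hslope := hcomp.le_slope_of_hasDerivAt (Set.mem_univ _) (Set.mem_univ _) one_pos hderiv
  simp only [slope_def_field, Function.comp_apply, AffineMap.lineMap_apply_one,
    AffineMap.lineMap_apply_zero, sub_zero, div_one] at hslope
  linarith

/-- A quadratic upper bound on a convex function forces a quadratic lower bound on its Bregman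
divergence in terms of the gradients. -/
theorem ConvexOn.norm_gradient_sub_sq_le_bregman {E : Type*} [NormedAddCommGroup E]
    [InnerProductSpace ℝ E] {φ : E → ℝ} {φ' : E → E} {ℓ : ℝ} (hℓ : 0 < ℓ)
    (hconv : ConvexOn ℝ Set.univ φ)
    (hdiff : ∀ x, HasFDerivAt φ (InnerProductSpace.toDualMap ℝ E (φ' x)) x)
    (hsmooth : ∀ x₁ x₂ : E,
      φ x₂ - φ x₁ - ⟪φ' x₁, x₂ - x₁⟫ ≤ ℓ / 2 * ‖x₁ - x₂‖ ^ 2)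
    (x y : E) :
    1 / (2 * ℓ) * ‖φ' x - φ' y‖ ^ 2 ≤ φ y - φ x - ⟪φ' x, y - x⟫ := by
  have hlower := hconv.add_fderiv_sub_le (hdiff x) (y + ℓ⁻¹ • (φ' x - φ' y))
  have hupper := hsmooth y (y + ℓ⁻¹ • (φ' x - φ' y))
  have hnorm : ‖φ' x - φ' y‖ ^ 2 = ⟪φ' x, φ' x - φ' y⟫ - ⟪φ' y, φ' x - φ' y⟫ := by
    rw [← inner_sub_left, real_inner_self_eq_norm_sq]
  rw [InnerProductSpace.toDualMap_apply_apply, add_sub_right_comm, inner_add_right,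
    inner_smul_right] at hlower
  rw [add_sub_cancel_left, sub_add_cancel_left, norm_neg, norm_smul, inner_smul_right, mul_pow,
    Real.norm_eq_abs, sq_abs] at hupper
  have hcoef : ℓ / 2 * (ℓ⁻¹ ^ 2 * ‖φ' x - φ' y‖ ^ 2) = ℓ⁻¹ / 2 * ‖φ' x - φ' y‖ ^ 2 := by
    field_simp
  have hhalf : 1 / (2 * ℓ) * ‖φ' x - φ' y‖ ^ 2 = ℓ⁻¹ / 2 * ‖φ' x - φ' y‖ ^ 2 := by
    field_simp
  have hscaled := congrArg (ℓ⁻¹ * ·) hnorm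
  simp only [mul_sub] at hscaled
  linarith

/-- cocoercivity of the gradient of a smooth convex function.
If `φ : E → ℝ` is convex and differentiable with gradient `φ'`, and satisfies the
descent-type upper bound `φ(x₂) − φ(x₁) − ⟪∇φ(x₁), x₂ − x₁⟫ ≤ (ℓ/2)‖x₁ − x₂‖²`
for some `ℓ > 0`, then
`⟪∇φ(x₁) − ∇φ(x₂), x₁ − x₂⟫ ≥ (1/ℓ)‖∇φ(x₁) − ∇φ(x₂)‖²`. -/
theorem stmt_1 {E : Type*} [NormedAddCommGroup E] [InnerProductSpace ℝ E]
    (φ : E → ℝ) (φ' : E → E) (ℓ : ℝ) (hℓ : 0 < ℓ)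
    (hconv : ConvexOn ℝ Set.univ φ)
    (hdiff : ∀ x, HasFDerivAt φ (InnerProductSpace.toDualMap ℝ E (φ' x)) x)
    (hsmooth : ∀ x₁ x₂ : E,
      φ x₂ - φ x₁ - ⟪φ' x₁, x₂ - x₁⟫ ≤ ℓ / 2 * ‖x₁ - x₂‖ ^ 2)
    (x₁ x₂ : E) :
    ⟪φ' x₁ - φ' x₂, x₁ - x₂⟫ ≥ 1 / ℓ * ‖φ' x₁ - φ' x₂‖ ^ 2 := by
  have h₁ := hconv.norm_gradient_sub_sq_le_bregman hℓ hdiff hsmooth x₁ x₂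
  have h₂ := hconv.norm_gradient_sub_sq_le_bregman hℓ hdiff hsmooth x₂ x₁
  rw [norm_sub_rev] at h₂
  have hhalf : 1 / ℓ * ‖φ' x₁ - φ' x₂‖ ^ 2 = 2 * (1 / (2 * ℓ) * ‖φ' x₁ - φ' x₂‖ ^ 2) := by
    field_simp
  rw [← neg_sub x₁ x₂, inner_neg_right] at h₁
  rw [inner_sub_left]
  linarith
end

section
/- (Convergence of Nesterov's Accelerated Gradient Descent.) Let E be a real inner product space and φ : E → ℝ be differentiable, ℓ-smooth and μ-strongly convex with 0 < μ ≤ ℓ, with unique global minimizer x*. Set κ = ℓ/μ, η = 1/ℓ and θ = (√κ − 1)/(√κ + 1). Given x₀ ∈ E, define sequences (x_k) and (x̃_k) by x̃₀ = x₀ and, for k ≥ 1, x_k = x̃_{k−1} − η∇φ(x̃_{k−1}) and x̃_k = x_k + θ(x_k − x_{k−1}). Then for every T ≥ 1: φ(x_T) − φ(x*) ≤ ((ℓ + μ)/2)·‖x₀ − x*‖²·exp(−T/√κ). -/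
open scoped RealInnerProductSpace

/-- The descent lemma: a function with `ℓ`-Lipschitz gradient lies below its quadratic upper model. -/
theorem le_quadratic_of_lipschitz_gradient {E : Type*} [NormedAddCommGroup E]
    [InnerProductSpace ℝ E] {φ : E → ℝ} {φ' : E → E} {ℓ : ℝ}
    (hdiff : ∀ x, HasFDerivAt φ (InnerProductSpace.toDualMap ℝ E (φ' x)) x)
    (hsmooth : ∀ x₁ x₂ : E, ‖φ' x₁ - φ' x₂‖ ≤ ℓ * ‖x₁ - x₂‖) (x d : E) :
    φ (x + d) ≤ φ x + ⟪φ' x, d⟫ + ℓ / 2 * ‖d‖ ^ 2 := by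
  have hderiv : ∀ t : ℝ, HasDerivAt
      (fun t : ℝ => φ (x + t • d) - (t * ⟪φ' x, d⟫ + t ^ 2 * (ℓ / 2 * ‖d‖ ^ 2)))
      (⟪φ' (x + t • d), d⟫ - (1 * ⟪φ' x, d⟫ + 2 * t * (ℓ / 2 * ‖d‖ ^ 2))) t := by
    intro t
    have hline : HasDerivAt (fun t : ℝ => x + t • d) d t := by
      simpa using ((hasDerivAt_id t).smul_const d).const_add x
    have hφ : HasDerivAt (fun t : ℝ => φ (x + t • d)) ⟪φ' (x + t • d), d⟫ t := by
      exact (hdiff (x + t • d)).comp_hasDerivAt t hline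
    have hsq : HasDerivAt (fun t : ℝ => t ^ 2) (2 * t) t := by
      simpa using hasDerivAt_pow 2 t
    exact hφ.sub (((hasDerivAt_id t).mul_const _).add (hsq.mul_const _))
  have hanti := antitoneOn_of_deriv_nonpos (convex_Icc (0 : ℝ) 1)
    (fun t _ => (hderiv t).continuousAt.continuousWithinAt)
    (fun t _ => (hderiv t).differentiableAt.differentiableWithinAt)
    (fun t ht => by
      rw [interior_Icc] at ht
      rw [(hderiv t).deriv]
      have hcs := real_inner_le_norm (φ' (x + t • d) - φ' x) d
      have hL := hsmooth (x + t • d) x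
      rw [add_sub_cancel_left, norm_smul, Real.norm_of_nonneg ht.1.le] at hL
      rw [inner_sub_left] at hcs
      nlinarith [mul_le_mul_of_nonneg_right hL (norm_nonneg d)])
  have h := hanti (Set.left_mem_Icc.2 zero_le_one) (Set.right_mem_Icc.2 zero_le_one) zero_le_one
  simp only [one_smul, zero_smul, add_zero] at h
  linarith

/-- One step of accelerated gradient descent contracts the Lyapunov function
`φ x - φ x* + μ / 2 * ‖v - x*‖ ^ 2`, `v = y + s • (y - x)`, by the factor `1 - 1 / s`,
where `s = √(ℓ / μ)`. -/
theorem accelerated_gradient_lyapunov_step {E : Type*} [NormedAddCommGroup E]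
    [InnerProductSpace ℝ E] {φ : E → ℝ} {φ' : E → E} {ℓ μ s : ℝ} (hμ : 0 < μ) (hs : 1 ≤ s)
    (hℓ : ℓ = μ * s ^ 2)
    (hdiff : ∀ x, HasFDerivAt φ (InnerProductSpace.toDualMap ℝ E (φ' x)) x)
    (hsmooth : ∀ x₁ x₂ : E, ‖φ' x₁ - φ' x₂‖ ≤ ℓ * ‖x₁ - x₂‖)
    (hsc : ∀ x₁ x₂ : E, φ x₂ ≥ φ x₁ + ⟪φ' x₁, x₂ - x₁⟫ + μ / 2 * ‖x₂ - x₁‖ ^ 2)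
    (xs x y : E) :
    φ (y - (1 / ℓ) • φ' y) - φ xs
        + μ / 2 * ‖s • (y - (1 / ℓ) • φ' y) - (s - 1) • x - xs‖ ^ 2
      ≤ (1 - 1 / s) * (φ x - φ xs + μ / 2 * ‖y + s • (y - x) - xs‖ ^ 2) := by
  have hs0 : 0 < s := by linarith
  have hℓ0 : 0 < ℓ := by rw [hℓ]; positivity
  have hdesc := le_quadratic_of_lipschitz_gradient hdiff hsmooth y (-((1 / ℓ) • φ' y))
  have hx := hsc y x
  have hxs := hsc y xs
  obtain ⟨a, ha⟩ : ∃ a, a = y - xs := ⟨_, rfl⟩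
  obtain ⟨b, hb⟩ : ∃ b, b = y - x := ⟨_, rfl⟩
  obtain ⟨g, hg⟩ : ∃ g, g = φ' y := ⟨_, rfl⟩
  have e1 : s • (y - (1 / ℓ) • φ' y) - (s - 1) • x - xs = a + (s - 1) • b - (s / ℓ) • g := by
    rw [ha, hb, hg]; module
  have e2 : y + s • (y - x) - xs = a + s • b := by rw [ha, hb]; module
  have e3 : x - y = -b := by rw [hb]; module
  have e4 : xs - y = -a := by rw [ha]; module
  rw [e1, e2]
  rw [e3] at hx
  rw [e4] at hxs
  rw [← sub_eq_add_neg] at hdesc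
  rw [← hg] at hdesc hx hxs ⊢
  have n1 : ‖a + (s - 1) • b - (s / ℓ) • g‖ ^ 2 = ‖a‖ ^ 2 + (s - 1) ^ 2 * ‖b‖ ^ 2
      + (s / ℓ) ^ 2 * ‖g‖ ^ 2 + 2 * (s - 1) * ⟪a, b⟫ - 2 * (s / ℓ) * ⟪g, a⟫
      - 2 * (s - 1) * (s / ℓ) * ⟪g, b⟫ := by
    rw [norm_sub_sq_real, norm_add_sq_real]
    simp only [inner_add_right, inner_smul_right, norm_smul, mul_pow,
      Real.norm_eq_abs, sq_abs, real_inner_comm g]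
    ring
  have n2 : ‖a + s • b‖ ^ 2 = ‖a‖ ^ 2 + s ^ 2 * ‖b‖ ^ 2 + 2 * s * ⟪a, b⟫ := by
    rw [norm_add_sq_real]
    simp only [inner_smul_right, norm_smul, mul_pow, Real.norm_eq_abs, sq_abs]
    ring
  rw [n1, n2]
  simp only [inner_neg_right, inner_smul_right, norm_neg, norm_smul, mul_pow,
    Real.norm_eq_abs, sq_abs, real_inner_self_eq_norm_sq] at hdesc hx hxs
  have hq : 0 ≤ 1 - 1 / s := by
    rw [sub_nonneg, div_le_one hs0]; exact hs
  have hq' : 0 ≤ 1 / s := by positivity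
  have hx' := mul_le_mul_of_nonneg_left hx hq
  have hxs' := mul_le_mul_of_nonneg_left hxs hq'
  have hB : 0 ≤ μ / 2 * ((s - 1) * ‖b‖ ^ 2) + (1 - 1 / s) * (μ / 2 * ‖b‖ ^ 2) := by
    have : 0 ≤ s - 1 := by linarith
    positivity
  refine sub_nonneg.1 (le_trans (add_nonneg (add_nonneg (sub_nonneg.2 hdesc)
    (add_nonneg (sub_nonneg.2 hx') (sub_nonneg.2 hxs'))) hB) (le_of_eq ?_))
  subst hℓ
  field_simp
  ring

/-- convergence of Nesterov's Accelerated Gradient Descent.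
Let `φ : E → ℝ` be differentiable with gradient `φ'`, `ℓ`-smooth, `μ`-strongly convex
(`0 < μ ≤ ℓ`), with unique global minimizer `xs`. With `κ = ℓ/μ`, `η = 1/ℓ`,
`θ = (√κ − 1)/(√κ + 1)`, the AGD iterates `x̃₀ = x₀`,
`x_k = x̃_{k−1} − η • ∇φ(x̃_{k−1})`, `x̃_k = x_k + θ • (x_k − x_{k−1})` satisfy, for all
`T ≥ 1`, `φ(x_T) − φ(x*) ≤ ((ℓ+μ)/2)‖x₀ − x*‖² exp(−T/√κ)`. -/
theorem stmt_4 {E : Type*} [NormedAddCommGroup E] [InnerProductSpace ℝ E]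
    (φ : E → ℝ) (φ' : E → E) (ℓ μ : ℝ) (hμ : 0 < μ) (hμℓ : μ ≤ ℓ)
    (hdiff : ∀ x, HasFDerivAt φ (InnerProductSpace.toDualMap ℝ E (φ' x)) x)
    (hsmooth : ∀ x₁ x₂ : E, ‖φ' x₁ - φ' x₂‖ ≤ ℓ * ‖x₁ - x₂‖)
    (hsc : ∀ x₁ x₂ : E, φ x₂ ≥ φ x₁ + ⟪φ' x₁, x₂ - x₁⟫ + μ / 2 * ‖x₂ - x₁‖ ^ 2)
    (xs : E) (hmin : ∀ x, φ xs ≤ φ x)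
    (κ η θ : ℝ) (hκ : κ = ℓ / μ) (hη : η = 1 / ℓ)
    (hθ : θ = (Real.sqrt κ - 1) / (Real.sqrt κ + 1))
    (x xt : ℕ → E)
    (hxt0 : xt 0 = x 0)
    (hstep : ∀ k : ℕ, x (k + 1) = xt k - η • φ' (xt k))
    (hmom : ∀ k : ℕ, xt (k + 1) = x (k + 1) + θ • (x (k + 1) - x k)) :
    ∀ T : ℕ, 1 ≤ T →
      φ (x T) - φ xs ≤
        (ℓ + μ) / 2 * ‖x 0 - xs‖ ^ 2 * Real.exp (-(T : ℝ) / Real.sqrt κ) := by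
  intro T _
  obtain ⟨s, hs⟩ : ∃ s, s = Real.sqrt κ := ⟨_, rfl⟩
  rw [← hs] at hθ ⊢
  have hℓ0 : 0 < ℓ := hμ.trans_le hμℓ
  have hκ1 : 1 ≤ κ := by rw [hκ, one_le_div hμ]; exact hμℓ
  have hs1 : 1 ≤ s := by rw [hs]; exact Real.one_le_sqrt.2 hκ1
  have hs0 : 0 < s := by linarith
  have hℓs : ℓ = μ * s ^ 2 := by
    rw [hs, Real.sq_sqrt (by linarith), hκ]; field_simp
  have hq : 0 ≤ 1 - 1 / s := by
    rw [sub_nonneg, div_le_one hs0]; exact hs1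
  have hgrad : φ' xs = 0 := by
    have h0 := IsLocalMin.hasFDerivAt_eq_zero (Filter.Eventually.of_forall hmin) (hdiff xs)
    have h1 := congrArg (fun L => L (φ' xs)) h0
    simpa using h1
  have hθs : (1 + s) * θ = s - 1 := by rw [hθ]; field_simp; ring
  have hlyap : ∀ k : ℕ, φ (x k) - φ xs + μ / 2 * ‖xt k + s • (xt k - x k) - xs‖ ^ 2
      ≤ (1 - 1 / s) ^ k * (φ (x 0) - φ xs + μ / 2 * ‖x 0 - xs‖ ^ 2) := by
    intro k
    induction k with
    | zero => simp [hxt0]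
    | succ k ih =>
      have hv : xt (k + 1) + s • (xt (k + 1) - x (k + 1)) - xs
          = s • x (k + 1) - (s - 1) • x k - xs := by
        rw [hmom, ← hθs]
        have : s • x (k + 1) = x (k + 1) + ((1 + s) * θ) • x (k + 1) := by
          rw [hθs]; module
        rw [this]; module
      have h := accelerated_gradient_lyapunov_step hμ hs1 hℓs hdiff hsmooth hsc xs (x k) (xt k)
      rw [← hη, ← hstep] at h
      rw [hv, pow_succ' (1 - 1 / s), mul_assoc]
      exact h.trans (mul_le_mul_of_nonneg_left ih hq)
  have hinit := le_quadratic_of_lipschitz_gradient hdiff hsmooth xs (x 0 - xs)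
  rw [hgrad, inner_zero_left, add_sub_cancel] at hinit
  have hrate : (1 - 1 / s) ^ T ≤ Real.exp (-(T : ℝ) / s) := by
    have h := pow_le_pow_left₀ hq (Real.one_sub_le_exp_neg (1 / s)) T
    rw [← Real.exp_nat_mul] at h
    rwa [mul_neg, mul_one_div, ← neg_div] at h
  calc φ (x T) - φ xs
      ≤ φ (x T) - φ xs + μ / 2 * ‖xt T + s • (xt T - x T) - xs‖ ^ 2 :=
        le_add_of_nonneg_right (by positivity)
    _ ≤ (1 - 1 / s) ^ T * (φ (x 0) - φ xs + μ / 2 * ‖x 0 - xs‖ ^ 2) := hlyap T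
    _ ≤ (1 - 1 / s) ^ T * ((ℓ + μ) / 2 * ‖x 0 - xs‖ ^ 2) :=
        mul_le_mul_of_nonneg_left (by linarith) (pow_nonneg hq T)
    _ ≤ Real.exp (-(T : ℝ) / s) * ((ℓ + μ) / 2 * ‖x 0 - xs‖ ^ 2) :=
        mul_le_mul_of_nonneg_right hrate (by positivity)
    _ = (ℓ + μ) / 2 * ‖x 0 - xs‖ ^ 2 * Real.exp (-(T : ℝ) / s) := mul_comm _ _
end

section
/- (Convergence of the Accelerated Proximal Forward-Backward algorithm, APFB.) Let g : ℝ^{d_x} → ℝ be μ_x-strongly convex, h : ℝ^{d_y} → ℝ be μ_y-strongly convex (μ_x, μ_y > 0), and A : ℝ^{d_y} → ℝ^{d_x} a linear map with operator norm ‖A‖ > 0. Let (x*, y*) be the saddle point of f(x,y) = g(x) + ⟨x, Ay⟩ − h(y). Set γ = (1/‖A‖)√(μ_y/μ_x), σ = (1/‖A‖)√(μ_x/μ_y), θ = ‖A‖/(√(μ_x μ_y) + ‖A‖). Given (x₀, y₀), define x_{−1} = x₀ (so x̃₀ = x₀) and for k ≥ 1: x̃_{k−1} = x_{k−1} + θ(x_{k−1}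 − x_{k−2}); y_k is the minimizer of v ↦ h(v) + (1/(2σ))‖v − y_{k−1} − σA^T x̃_{k−1}‖²; x_k is the minimizer of u ↦ g(u) + (1/(2γ))‖u − x_{k−1} + γA y_k‖². Then for every T ≥ 1: μ_x‖x_T − x*‖² + μ_y‖y_T − y*‖² ≤ θ^{T−1}·(‖A‖/√(μ_x μ_y))·(μ_x‖x₀ − x*‖² + μ_y‖y₀ − y*‖²). -/
open scoped RealInnerProductSpace

/-- A minimizer of `φ + c‖· - w‖²`, with `φ` `μ`-strongly convex, is a minimizer with quadratic
growth of modulus `μ / 2 + c`. -/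
theorem quadratic_growth_of_minimizer {E : Type*} [NormedAddCommGroup E] [InnerProductSpace ℝ E]
    {φ : E → ℝ} {μ c : ℝ} (hμc : 0 ≤ μ / 2 + c)
    (hφ : ConvexOn ℝ Set.univ (fun x => φ x - μ / 2 * ‖x‖ ^ 2)) {p w : E}
    (hp : ∀ u, φ p + c * ‖p - w‖ ^ 2 ≤ φ u + c * ‖u - w‖ ^ 2) (u : E) :
    φ p + c * ‖p - w‖ ^ 2 + (μ / 2 + c) * ‖u - p‖ ^ 2 ≤ φ u + c * ‖u - w‖ ^ 2 := by
  have key : ∀ t : ℝ, 0 < t → t < 1 →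
      φ p + c * ‖p - w‖ ^ 2 + (1 - t) * ((μ / 2 + c) * ‖u - p‖ ^ 2) ≤
        φ u + c * ‖u - w‖ ^ 2 := by
    intro t ht0 ht1
    have hconv := (strongConvexOn_iff_convex.2 hφ).2 (Set.mem_univ p) (Set.mem_univ u)
      (sub_nonneg.2 ht1.le) ht0.le (sub_add_cancel 1 t)
    simp only [smul_eq_mul] at hconv
    have hnorm : ‖(1 - t) • p + t • u - w‖ ^ 2 =
        (1 - t) * ‖p - w‖ ^ 2 + t * ‖u - w‖ ^ 2 - t * (1 - t) * ‖u - p‖ ^ 2 := by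
      rw [show (1 - t) • p + t • u - w = (1 - t) • (p - w) + t • (u - w) by module,
        show u - p = (u - w) - (p - w) by abel, norm_add_sq_real, norm_sub_sq_real (u - w),
        norm_smul, norm_smul, real_inner_smul_left, real_inner_smul_right,
        real_inner_comm (p - w), mul_pow, mul_pow, Real.norm_eq_abs, Real.norm_eq_abs,
        sq_abs, sq_abs]
      ring
    have hmin := hp ((1 - t) • p + t • u)
    rw [hnorm] at hmin
    rw [norm_sub_rev p u] at hconv
    refine le_of_mul_le_mul_left ?_ ht0
    linarith
  have hb : 0 ≤ (μ / 2 + c) * ‖u - p‖ ^ 2 := by positivity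
  set b := (μ / 2 + c) * ‖u - p‖ ^ 2
  refine le_of_forall_pos_le_add fun ε hε => ?_
  have ht := key (ε / (b + 2 * ε)) (by positivity) (by rw [div_lt_one (by positivity)]; linarith)
  have hbound : ε / (b + 2 * ε) * b ≤ ε := by
    rw [div_mul_eq_mul_div, div_le_iff₀ (by positivity)]
    nlinarith
  linarith

/-- Three-point inequality for a proximal step on a strongly convex function plus a linear
term. -/
theorem proximal_three_point {E : Type*} [NormedAddCommGroup E] [InnerProductSpace ℝ E]
    {φ : E → ℝ} {μ τ : ℝ} (hμ : 0 ≤ μ) (hτ : 0 < τ)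
    (hφ : ConvexOn ℝ Set.univ (fun x => φ x - μ / 2 * ‖x‖ ^ 2)) {p x a : E}
    (hp : ∀ u, φ p + 1 / (2 * τ) * ‖p - x + τ • a‖ ^ 2 ≤
      φ u + 1 / (2 * τ) * ‖u - x + τ • a‖ ^ 2) (u : E) :
    φ p + ⟪p, a⟫ + 1 / (2 * τ) * ‖p - x‖ ^ 2 + (μ / 2 + 1 / (2 * τ)) * ‖u - p‖ ^ 2 ≤
      φ u + ⟪u, a⟫ + 1 / (2 * τ) * ‖u - x‖ ^ 2 := by
  have hgrowth := quadratic_growth_of_minimizer (c := 1 / (2 * τ)) (w := x - τ • a)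
    (by positivity) hφ (by simpa only [sub_add] using hp) u
  have hexp : ∀ v : E, 1 / (2 * τ) * ‖v - (x - τ • a)‖ ^ 2 =
      1 / (2 * τ) * ‖v - x‖ ^ 2 + ⟪v, a⟫ - ⟪x, a⟫ + τ / 2 * ‖a‖ ^ 2 := by
    intro v
    rw [← sub_add, norm_add_sq_real, norm_smul, real_inner_smul_right, inner_sub_left, mul_pow,
      Real.norm_eq_abs, sq_abs]
    field_simp
    ring
  rw [hexp, hexp] at hgrowth
  linarith

/-- Young's inequality for a bilinear coupling, with weights satisfying `γ σ ‖A‖² = 1`. -/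
theorem abs_inner_map_le_weighted {E F : Type*} [NormedAddCommGroup E] [InnerProductSpace ℝ E]
    [NormedAddCommGroup F] [InnerProductSpace ℝ F] (A : F →L[ℝ] E) {γ σ : ℝ} (hγ : 0 < γ)
    (hσ : 0 < σ) (hγσ : γ * σ * ‖A‖ ^ 2 = 1) (u : E) (v : F) :
    |⟪u, A v⟫| ≤ 1 / (2 * γ) * ‖u‖ ^ 2 + 1 / (2 * σ) * ‖v‖ ^ 2 := by
  have hle : |⟪u, A v⟫| ≤ ‖u‖ * (‖A‖ * ‖v‖) :=
    (abs_real_inner_le_norm u (A v)).trans (by gcongr; exact A.le_opNorm v)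
  refine hle.trans ?_
  have hσ' : 1 / (2 * σ) = γ * ‖A‖ ^ 2 / 2 := by
    rw [div_eq_div_iff (by positivity) two_ne_zero]
    linarith
  have hsq : 1 / (2 * γ) * ‖u‖ ^ 2 + 1 / (2 * σ) * ‖v‖ ^ 2 - ‖u‖ * (‖A‖ * ‖v‖) =
      1 / (2 * γ) * (‖u‖ - γ * ‖A‖ * ‖v‖) ^ 2 := by
    rw [hσ']
    field_simp
    ring
  have : 0 ≤ 1 / (2 * γ) * (‖u‖ - γ * ‖A‖ * ‖v‖) ^ 2 := by positivity
  linarith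

/-- convergence of the Accelerated Proximal Forward-Backward algorithm.
For `g` `μx`-strongly convex, `h` `μy`-strongly convex, `A` linear with `‖A‖ > 0`,
`(xs, ys)` the saddle point of `f(x,y) = g(x) + ⟪x, Ay⟫ − h(y)`, and the APFB iterates
(with `γ = (1/‖A‖)√(μy/μx)`, `σ = (1/‖A‖)√(μx/μy)`, `θ = ‖A‖/(√(μxμy) + ‖A‖)`,
`x̃₀ = x₀` since `x₋₁ = x₀`), for all `T ≥ 1`:
`μx‖x_T − x*‖² + μy‖y_T − y*‖² ≤ θ^{T−1}(‖A‖/√(μxμy))(μx‖x₀ − x*‖² + μy‖y₀ − y*‖²)`. -/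
theorem stmt_5 {dx dy : ℕ}
    (g : EuclideanSpace ℝ (Fin dx) → ℝ) (h : EuclideanSpace ℝ (Fin dy) → ℝ)
    (μx μy : ℝ) (hμx : 0 < μx) (hμy : 0 < μy)
    (A : EuclideanSpace ℝ (Fin dy) →L[ℝ] EuclideanSpace ℝ (Fin dx)) (hA : 0 < ‖A‖)
    (hg : ConvexOn ℝ Set.univ (fun x => g x - μx / 2 * ‖x‖ ^ 2))
    (hh : ConvexOn ℝ Set.univ (fun y => h y - μy / 2 * ‖y‖ ^ 2))
    (xs : EuclideanSpace ℝ (Fin dx)) (ys : EuclideanSpace ℝ (Fin dy))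
    (hsaddle : ∀ (x : EuclideanSpace ℝ (Fin dx)) (y : EuclideanSpace ℝ (Fin dy)),
      g xs + ⟪xs, A y⟫ - h y ≤ g xs + ⟪xs, A ys⟫ - h ys ∧
      g xs + ⟪xs, A ys⟫ - h ys ≤ g x + ⟪x, A ys⟫ - h ys)
    (γ σ θ : ℝ)
    (hγ : γ = 1 / ‖A‖ * Real.sqrt (μy / μx))
    (hσ : σ = 1 / ‖A‖ * Real.sqrt (μx / μy))
    (hθ : θ = ‖A‖ / (Real.sqrt (μx * μy) + ‖A‖))
    (x xt : ℕ → EuclideanSpace ℝ (Fin dx)) (y : ℕ → EuclideanSpace ℝ (Fin dy))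
    (hxt0 : xt 0 = x 0)
    (hxt : ∀ k : ℕ, xt (k + 1) = x (k + 1) + θ • (x (k + 1) - x k))
    (hy : ∀ (k : ℕ) (v : EuclideanSpace ℝ (Fin dy)),
      h (y (k + 1)) + 1 / (2 * σ) * ‖y (k + 1) - y k - σ • (ContinuousLinearMap.adjoint A) (xt k)‖ ^ 2 ≤
        h v + 1 / (2 * σ) * ‖v - y k - σ • (ContinuousLinearMap.adjoint A) (xt k)‖ ^ 2)
    (hx : ∀ (k : ℕ) (u : EuclideanSpace ℝ (Fin dx)),
      g (x (k + 1)) + 1 / (2 * γ) * ‖x (k + 1) - x k + γ • A (y (k + 1))‖ ^ 2 ≤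
        g u + 1 / (2 * γ) * ‖u - x k + γ • A (y (k + 1))‖ ^ 2) :
    ∀ T : ℕ, 1 ≤ T →
      μx * ‖x T - xs‖ ^ 2 + μy * ‖y T - ys‖ ^ 2 ≤
        θ ^ (T - 1) * (‖A‖ / Real.sqrt (μx * μy)) *
          (μx * ‖x 0 - xs‖ ^ 2 + μy * ‖y 0 - ys‖ ^ 2) := by
  set s := Real.sqrt (μx * μy) with hs
  have hs0 : 0 < s := Real.sqrt_pos.2 (mul_pos hμx hμy)
  have hs2 : s ^ 2 = μx * μy := Real.sq_sqrt (mul_pos hμx hμy).le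
  have hγ' : γ = s / (‖A‖ * μx) := by
    rw [hγ, show μy / μx = μx * μy / μx ^ 2 by field_simp, Real.sqrt_div (by positivity),
      Real.sqrt_sq hμx.le, ← hs]
    field_simp
  have hσ' : σ = s / (‖A‖ * μy) := by
    rw [hσ, show μx / μy = μx * μy / μy ^ 2 by field_simp, Real.sqrt_div (by positivity),
      Real.sqrt_sq hμy.le, ← hs]
    field_simp
  have hγ0 : 0 < γ := by rw [hγ']; positivity
  have hσ0 : 0 < σ := by rw [hσ']; positivity
  have hγσ : γ * σ * ‖A‖ ^ 2 = 1 := by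
    rw [hγ', hσ']
    field_simp
    exact hs2
  have hθ0 : 0 < θ := by rw [hθ]; positivity
  have hθρ : θ * (1 + s / ‖A‖) = 1 := by
    rw [hθ]
    field_simp
    ring
  have hγμ : 1 / (2 * γ) = ‖A‖ / (2 * s) * μx := by rw [hγ']; field_simp
  have hσμ : 1 / (2 * σ) = ‖A‖ / (2 * s) * μy := by rw [hσ']; field_simp
  have hγρ : μx / 2 + 1 / (2 * γ) = (1 + s / ‖A‖) * (1 / (2 * γ)) := by
    rw [hγμ]; field_simp; ring
  have hσρ : μy / 2 + 1 / (2 * σ) = (1 + s / ‖A‖) * (1 / (2 * σ)) := by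
    rw [hσμ]; field_simp; ring
  have hyoung := abs_inner_map_le_weighted A hγ0 hσ0 hγσ
  -- One iteration, for an extrapolation point `x k + θ • d`.
  have hstep : ∀ (k : ℕ) (d : EuclideanSpace ℝ (Fin dx)), xt k = x k + θ • d →
      (1 + s / ‖A‖) *
          (1 / (2 * γ) * ‖x (k + 1) - xs‖ ^ 2 + 1 / (2 * σ) * ‖y (k + 1) - ys‖ ^ 2) +
          (1 / (2 * γ) * ‖x (k + 1) - x k‖ ^ 2 + ⟪x (k + 1) - x k, A (y (k + 1) - ys)⟫) ≤
        1 / (2 * γ) * ‖x k - xs‖ ^ 2 + 1 / (2 * σ) * ‖y k - ys‖ ^ 2 +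
          θ * (1 / (2 * γ) * ‖d‖ ^ 2 + ⟪d, A (y k - ys)⟫) := by
    intro k d hd
    have hX := proximal_three_point hμx.le hγ0 hg (hx k) xs
    have hY := proximal_three_point (a := -(ContinuousLinearMap.adjoint A) (xt k)) hμy.le hσ0 hh
      (by simpa only [smul_neg, ← sub_eq_add_neg] using hy k) ys
    obtain ⟨hsaddle_y, hsaddle_x⟩ := hsaddle (x (k + 1)) (y (k + 1))
    rw [hγρ, norm_sub_rev xs, norm_sub_rev xs] at hX
    rw [hσρ, norm_sub_rev ys, norm_sub_rev ys, inner_neg_right, inner_neg_right,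
      ContinuousLinearMap.adjoint_inner_right, ContinuousLinearMap.adjoint_inner_right,
      real_inner_comm, real_inner_comm (xt k) (A ys), hd] at hY
    have hcross := (abs_le.1 (hyoung d (y (k + 1) - y k))).2
    have hcross' := mul_le_mul_of_nonneg_left hcross hθ0.le
    have hθ1 : θ ≤ 1 := by
      rw [hθ]
      exact div_le_one_of_le₀ (by linarith) (by positivity)
    have hslack : θ * (1 / (2 * σ) * ‖y (k + 1) - y k‖ ^ 2) ≤
        1 / (2 * σ) * ‖y (k + 1) - y k‖ ^ 2 :=
      mul_le_of_le_one_left (by positivity) hθ1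
    simp only [map_sub, inner_sub_left, inner_sub_right, inner_add_left,
      real_inner_smul_left] at *
    linarith
  obtain ⟨d, hd0, hd⟩ : ∃ d : ℕ → EuclideanSpace ℝ (Fin dx),
      d 0 = 0 ∧ ∀ k, d (k + 1) = x (k + 1) - x k :=
    ⟨fun k => Nat.casesOn k 0 fun j => x (j + 1) - x j, rfl, fun _ => rfl⟩
  have hxd : ∀ k, xt k = x k + θ • d k := by
    rintro (_ | k)
    · rw [hxt0, hd0, smul_zero, add_zero]
    · rw [hxt, hd]
  set D : ℕ → ℝ := fun k => 1 / (2 * γ) * ‖x k - xs‖ ^ 2 + 1 / (2 * σ) * ‖y k - ys‖ ^ 2 with hD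
  set C : ℕ → ℝ := fun k => 1 / (2 * γ) * ‖d k‖ ^ 2 + ⟪d k, A (y k - ys)⟫ with hC
  have hrec : ∀ k, (1 + s / ‖A‖) * D (k + 1) + C (k + 1) ≤ D k + θ * C k := by
    intro k
    simpa only [hD, hC, hd] using hstep k (d k) (hxd k)
  have hgeom : ∀ k, D k + θ * C k ≤ θ ^ k * D 0 := by
    intro k
    induction k with
    | zero => simp [hC, hd0]
    | succ k ih =>
      calc D (k + 1) + θ * C (k + 1)
          = θ * ((1 + s / ‖A‖) * D (k + 1) + C (k + 1)) := by
            linear_combination -D (k + 1) * hθρ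
        _ ≤ θ * (θ ^ k * D 0) := by gcongr; exact (hrec k).trans ih
        _ = θ ^ (k + 1) * D 0 := by ring
  have hDμ : ∀ k, D k = ‖A‖ / (2 * s) * (μx * ‖x k - xs‖ ^ 2 + μy * ‖y k - ys‖ ^ 2) := by
    intro k
    simp only [hD, hγμ, hσμ]
    ring
  intro T hT
  obtain ⟨k, rfl⟩ : ∃ k, T = k + 1 := ⟨T - 1, by omega⟩
  have hlower : -D (k + 1) ≤ C (k + 1) := by
    have h1 := (abs_le.1 (hyoung (d (k + 1)) (y (k + 1) - ys))).1
    have h2 : 0 ≤ 1 / (2 * γ) * ‖x (k + 1) - xs‖ ^ 2 := by positivity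
    simp only [hD, hC]
    linarith
  have hfinal : s / ‖A‖ * D (k + 1) ≤ θ ^ k * D 0 := by
    linarith [(hrec k).trans (hgeom k)]
  rw [hDμ, hDμ] at hfinal
  rw [Nat.add_sub_cancel]
  calc μx * ‖x (k + 1) - xs‖ ^ 2 + μy * ‖y (k + 1) - ys‖ ^ 2
      = 2 * (s / ‖A‖ * (‖A‖ / (2 * s) *
          (μx * ‖x (k + 1) - xs‖ ^ 2 + μy * ‖y (k + 1) - ys‖ ^ 2))) := by
        field_simp
    _ ≤ 2 * (θ ^ k * (‖A‖ / (2 * s) * (μx * ‖x 0 - xs‖ ^ 2 + μy * ‖y 0 - ys‖ ^ 2))) := by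
        gcongr
    _ = θ ^ k * (‖A‖ / s) * (μx * ‖x 0 - xs‖ ^ 2 + μy * ‖y 0 - ys‖ ^ 2) := by
        field_simp
end

section
/- (Contraction of the Double Proximal Point Algorithm, DPPA.) Let g : ℝ^{d_x} → ℝ and h : ℝ^{d_y} → ℝ both be differentiable, L-smooth and μ-strongly convex with 0 < μ ≤ L, let A : ℝ^{d_y} → ℝ^{d_x} be linear, and let (x*, y*) be the saddle point of f(x,y) = g(x) + ⟨x, Ay⟩ − h(y). Set α = 1/√(Lμ), κ = L/μ, η = ((√κ − 1)/(√κ + 1))², z* = x* − αAy*, w* = y* + αA^T x*. Define, for k ≥ 1: z_k = x_{k−1} − αAy_{k−1}; w_k = y_{k−1} + αA^T x_{k−1}; x̃_k is the minimizer of x ↦ αg(x) + (1/2)‖x − z_k‖²; ỹ_k is the minimizer of y ↦ αh(y) + (1/2)‖y − w_k‖²; and (x_k, y_k) solves x_k + αA y_k = 2x̃_k − z_k and y_k − αA^T x_k = 2ỹ_k − w_k. Then for every k ≥ 1: ‖z_{k+1} − z*‖² + ‖w_{k+1} − w*‖² ≤ η·(‖z_k − z*‖² + ‖w_k − w*‖²).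 -/
open scoped RealInnerProductSpace

section GradientLemmas

variable {E : Type*} [NormedAddCommGroup E] [InnerProductSpace ℝ E] [CompleteSpace E]

/-- First-order optimality for a minimizer of `a φ + ⟪·, c⟫ + b ‖· - z‖²`. -/
theorem HasGradientAt.smul_add_eq_zero_of_forall_le {φ : E → ℝ} {G x c z : E} {a b : ℝ}
    (hφ : HasGradientAt φ G x)
    (hmin : ∀ u, a * φ x + ⟪x, c⟫ + b * ‖x - z‖ ^ 2 ≤ a * φ u + ⟪u, c⟫ + b * ‖u - z‖ ^ 2) :
    a • G + c + (2 * b) • (x - z) = 0 := by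
  have h1 := hφ.hasFDerivAt.const_mul a
  have h2 : HasFDerivAt (fun u : E => ⟪u, c⟫) (InnerProductSpace.toDual ℝ E c) x := by
    refine (InnerProductSpace.toDual ℝ E c).hasFDerivAt.congr_of_eventuallyEq ?_
    exact Filter.Eventually.of_forall fun u => by simp [real_inner_comm]
  have h3 := (((hasFDerivAt_id x).sub_const z).norm_sq).const_mul b
  have h4 := IsLocalMin.hasFDerivAt_eq_zero
    (Filter.Eventually.of_forall hmin) ((h1.add h2).add h3)
  refine ext_inner_right ℝ fun v => ?_
  have h5 := DFunLike.congr_fun h4 v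
  simp only [add_apply, smul_apply,
    InnerProductSpace.toDual_apply_apply, ContinuousLinearMap.comp_apply, innerSL_apply_apply,
    zero_apply, smul_eq_mul, id_eq, nsmul_eq_mul, Nat.cast_ofNat,
    ContinuousLinearMap.id_apply] at h5
  simp only [inner_add_left, real_inner_smul_left, inner_zero_left]
  linarith

/-- The descent lemma for functions with Lipschitz gradient. -/
theorem le_quadratic_of_gradient_lipschitz {φ : E → ℝ} {φ' : E → E} {L : ℝ}
    (hφ : ∀ u, HasGradientAt φ (φ' u) u) (hL : ∀ u v, ‖φ' u - φ' v‖ ≤ L * ‖u - v‖) (u v : E) :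
    φ v ≤ φ u + ⟪φ' u, v - u⟫ + L / 2 * ‖v - u‖ ^ 2 := by
  set d := v - u with hd
  have hderiv (t : ℝ) : HasDerivAt
      (fun t : ℝ => φ (u + t • d) - t * ⟪φ' u, d⟫ - L / 2 * ‖d‖ ^ 2 * t ^ 2)
      (⟪φ' (u + t • d), d⟫ - ⟪φ' u, d⟫ - L / 2 * ‖d‖ ^ 2 * (2 * t)) t := by
    have hline : HasDerivAt (fun t : ℝ => u + t • d) d t := by
      simpa using ((hasDerivAt_id t).smul_const d).const_add u
    have h1 := (hφ (u + t • d)).hasFDerivAt.comp_hasDerivAt t hline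
    have h2 := (hasDerivAt_id t).mul_const ⟪φ' u, d⟫
    have h3 := (hasDerivAt_pow 2 t).const_mul (L / 2 * ‖d‖ ^ 2)
    refine ((h1.sub h2).sub h3).congr_deriv ?_
    simp
  have hanti := antitoneOn_of_deriv_nonpos (convex_Icc (0 : ℝ) 1)
    (fun t _ => (hderiv t).continuousAt.continuousWithinAt)
    (fun t _ => (hderiv t).differentiableAt.differentiableWithinAt)
    (fun t ht => by
      rw [interior_Icc] at ht
      rw [(hderiv t).deriv]
      have h1 := real_inner_le_norm (φ' (u + t • d) - φ' u) d
      have h2 := hL (u + t • d) u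
      rw [add_sub_cancel_left, norm_smul, Real.norm_of_nonneg ht.1.le] at h2
      rw [inner_sub_left] at h1
      nlinarith [norm_nonneg d])
  have := hanti (Set.left_mem_Icc.2 zero_le_one) (Set.right_mem_Icc.2 zero_le_one) zero_le_one
  simp only [one_smul, zero_smul, add_zero, hd, add_sub_cancel] at this
  simp only [hd]
  linarith

/-- Nesterov's coercivity inequality for the gradient of a smooth strongly convex function. -/
theorem norm_sq_gradient_sub_add_le {φ : E → ℝ} {φ' : E → E} {L μ : ℝ} (hμL : μ ≤ L)
    (hφ : ∀ u, HasGradientAt φ (φ' u) u) (hL : ∀ u v, ‖φ' u - φ' v‖ ≤ L * ‖u - v‖)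
    (hsc : ∀ u v, φ v ≥ φ u + ⟪φ' u, v - u⟫ + μ / 2 * ‖v - u‖ ^ 2) (u v : E) :
    ‖φ' u - φ' v‖ ^ 2 + L * μ * ‖u - v‖ ^ 2 ≤ (L + μ) * ⟪φ' u - φ' v, u - v⟫ := by
  set D := φ' u - φ' v - μ • (u - v) with hD
  set c := ⟪D, u - v⟫ with hc
  have key (t : ℝ) : 2 * t * ‖D‖ ^ 2 ≤ c + (L - μ) * t ^ 2 * ‖D‖ ^ 2 := by
    have h1 := hsc u (v + t • D)
    have h2 := le_quadratic_of_gradient_lipschitz hφ hL v (v + t • D)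
    have h3 := hsc v (u - t • D)
    have h4 := le_quadratic_of_gradient_lipschitz hφ hL u (u - t • D)
    have e1 : v + t • D - u = t • D - (u - v) := by abel
    have e3 : u - t • D - v = (u - v) - t • D := by abel
    have e2 : v + t • D - v = t • D := by abel
    have e4 : u - t • D - u = -(t • D) := by abel
    have hDD : ‖D‖ ^ 2 = ⟪φ' u, D⟫ - ⟪φ' v, D⟫ - μ * ⟪u - v, D⟫ := by
      rw [← real_inner_self_eq_norm_sq]
      nth_rewrite 1 [hD]
      rw [inner_sub_left, inner_sub_left, real_inner_smul_left]
    have hcc : c = ⟪φ' u, u - v⟫ - ⟪φ' v, u - v⟫ - μ * ‖u - v‖ ^ 2 := by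
      rw [hc, hD, inner_sub_left, inner_sub_left, real_inner_smul_left,
        real_inner_self_eq_norm_sq]
    have hcomm : ⟪D, u - v⟫ = ⟪u - v, D⟫ := real_inner_comm _ _
    rw [e1] at h1
    rw [e2] at h2
    rw [e3] at h3
    rw [e4, norm_neg] at h4
    rw [norm_sub_sq_real] at h1 h3
    simp only [inner_neg_right, inner_sub_right _ (t • D), inner_sub_right _ _ (t • D),
      real_inner_smul_left, real_inner_smul_right, norm_smul, mul_pow,
      Real.norm_eq_abs, sq_abs] at h1 h2 h3 h4
    rw [hcomm] at h1
    have hDt := congrArg (fun r => 2 * t * r) hDD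
    linarith
  have hfinal : ‖D‖ ^ 2 ≤ (L - μ) * c := by
    rcases hμL.eq_or_lt with h | h
    · subst h
      by_contra! hpos
      have hpos' : 0 < ‖D‖ ^ 2 := by linarith
      have := key ((c + 1) / (2 * ‖D‖ ^ 2))
      rw [show 2 * ((c + 1) / (2 * ‖D‖ ^ 2)) * ‖D‖ ^ 2 = c + 1 by
        rw [← mul_div_assoc, mul_div_mul_left _ _ two_ne_zero, div_mul_cancel₀ _ hpos'.ne']]
        at this
      linarith
    · have hM : 0 < L - μ := sub_pos.2 h
      have := mul_le_mul_of_nonneg_left (key (1 / (L - μ))) hM.le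
      field_simp at this
      linarith
  have hexp : ‖D‖ ^ 2 = ‖φ' u - φ' v‖ ^ 2 - 2 * μ * ⟪φ' u - φ' v, u - v⟫
      + μ ^ 2 * ‖u - v‖ ^ 2 := by
    rw [hD, norm_sub_sq_real, real_inner_smul_right, norm_smul, mul_pow, Real.norm_eq_abs, sq_abs]
    ring
  have hcexp : c = ⟪φ' u - φ' v, u - v⟫ - μ * ‖u - v‖ ^ 2 := by
    rw [hc, hD, inner_sub_left, real_inner_smul_left, real_inner_self_eq_norm_sq]
  rw [hexp, hcexp] at hfinal
  linarith

/-- The reflected resolvent of the gradient with step `1 / √(L μ)` contracts squared distances by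
`((√(L / μ) - 1) / (√(L / μ) + 1)) ^ 2`. -/
theorem norm_sq_reflected_prox_sub_le {φ : E → ℝ} {φ' : E → E} {L μ : ℝ} (hμ : 0 < μ)
    (hμL : μ ≤ L) (hφ : ∀ u, HasGradientAt φ (φ' u) u)
    (hL : ∀ u v, ‖φ' u - φ' v‖ ≤ L * ‖u - v‖)
    (hsc : ∀ u v, φ v ≥ φ u + ⟪φ' u, v - u⟫ + μ / 2 * ‖v - u‖ ^ 2) (u v : E) :
    ‖(u - v) - (1 / √(L * μ)) • (φ' u - φ' v)‖ ^ 2 ≤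
      ((√(L / μ) - 1) / (√(L / μ) + 1)) ^ 2 *
        ‖(u - v) + (1 / √(L * μ)) • (φ' u - φ' v)‖ ^ 2 := by
  have hco := norm_sq_gradient_sub_add_le hμL hφ hL hsc u v
  set d := u - v
  set D := φ' u - φ' v
  set s := √(L / μ) with hs
  have hLpos : 0 < L := hμ.trans_le hμL
  have hspos : 0 < s := Real.sqrt_pos.2 (div_pos hLpos hμ)
  have hL' : L = s ^ 2 * μ := by
    rw [hs, Real.sq_sqrt (div_pos hLpos hμ).le]
    field_simp
  have hα : √(L * μ) = s * μ := by
    rw [hL', show s ^ 2 * μ * μ = (s * μ) ^ 2 by ring, Real.sqrt_sq (by positivity)]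
  rw [hα, norm_sub_sq_real, norm_add_sq_real, real_inner_smul_right, norm_smul, mul_pow,
    Real.norm_eq_abs, sq_abs, real_inner_comm, div_pow (s - 1),
    div_mul_eq_mul_div ((s - 1) ^ 2), le_div_iff₀ (by positivity)]
  rw [hL'] at hco
  have hco' := mul_le_mul_of_nonneg_left hco (show 0 ≤ 4 / (s * μ ^ 2) by positivity)
  have e1 : 4 / (s * μ ^ 2) * (‖D‖ ^ 2 + s ^ 2 * μ * μ * ‖d‖ ^ 2) =
      4 * s * (‖d‖ ^ 2 + (1 / (s * μ)) ^ 2 * ‖D‖ ^ 2) := by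
    field_simp
    ring
  have e2 : 4 / (s * μ ^ 2) * ((s ^ 2 * μ + μ) * ⟪D, d⟫) =
      4 * (s ^ 2 + 1) * (1 / (s * μ) * ⟪D, d⟫) := by
    field_simp
  rw [e1, e2] at hco'
  linarith

end GradientLemmas

/-- The operators `(X, Y) ↦ (X ∓ α A Y, Y ± α Aᵀ X)` have the same norm at every point. -/
theorem norm_sq_sub_add_norm_sq_add_adjoint {E F : Type*}
    [NormedAddCommGroup E] [InnerProductSpace ℝ E] [CompleteSpace E]
    [NormedAddCommGroup F] [InnerProductSpace ℝ F] [CompleteSpace F]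
    (A : F →L[ℝ] E) (α : ℝ) (X : E) (Y : F) :
    ‖X - α • A Y‖ ^ 2 + ‖Y + α • ContinuousLinearMap.adjoint A X‖ ^ 2 =
      ‖X + α • A Y‖ ^ 2 + ‖Y - α • ContinuousLinearMap.adjoint A X‖ ^ 2 := by
  simp only [norm_sub_sq_real, norm_add_sq_real, real_inner_smul_right,
    ContinuousLinearMap.adjoint_inner_right]
  rw [real_inner_comm X (A Y)]
  ring

/-- contraction of the Double Proximal Point Algorithm, DPPA.
With `g, h` differentiable, `L`-smooth, `μ`-strongly convex (`0 < μ ≤ L`),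
`(xs, ys)` the saddle point of `f(x,y) = g(x) + ⟪x, Ay⟫ − h(y)`, `α = 1/√(Lμ)`,
`η = ((√κ − 1)/(√κ + 1))²`, `z* = x* − αAy*`, `w* = y* + αAᵀx*`, the DPPA iterates
satisfy `‖z_{k+1} − z*‖² + ‖w_{k+1} − w*‖² ≤ η(‖z_k − z*‖² + ‖w_k − w*‖²)` for `k ≥ 1`. -/
theorem stmt_6 {dx dy : ℕ}
    (g : EuclideanSpace ℝ (Fin dx) → ℝ) (h : EuclideanSpace ℝ (Fin dy) → ℝ)
    (g' : EuclideanSpace ℝ (Fin dx) → EuclideanSpace ℝ (Fin dx))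
    (h' : EuclideanSpace ℝ (Fin dy) → EuclideanSpace ℝ (Fin dy))
    (L μ : ℝ) (hμ : 0 < μ) (hμL : μ ≤ L)
    (hgdiff : ∀ u, HasGradientAt g (g' u) u) (hhdiff : ∀ v, HasGradientAt h (h' v) v)
    (hgsmooth : ∀ u₁ u₂, ‖g' u₁ - g' u₂‖ ≤ L * ‖u₁ - u₂‖)
    (hhsmooth : ∀ v₁ v₂, ‖h' v₁ - h' v₂‖ ≤ L * ‖v₁ - v₂‖)
    (hgsc : ∀ u₁ u₂, g u₂ ≥ g u₁ + ⟪g' u₁, u₂ - u₁⟫ + μ / 2 * ‖u₂ - u₁‖ ^ 2)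
    (hhsc : ∀ v₁ v₂, h v₂ ≥ h v₁ + ⟪h' v₁, v₂ - v₁⟫ + μ / 2 * ‖v₂ - v₁‖ ^ 2)
    (A : EuclideanSpace ℝ (Fin dy) →L[ℝ] EuclideanSpace ℝ (Fin dx))
    (xs : EuclideanSpace ℝ (Fin dx)) (ys : EuclideanSpace ℝ (Fin dy))
    (hsaddle : ∀ (x : EuclideanSpace ℝ (Fin dx)) (y : EuclideanSpace ℝ (Fin dy)),
      g xs + ⟪xs, A y⟫ - h y ≤ g xs + ⟪xs, A ys⟫ - h ys ∧
      g xs + ⟪xs, A ys⟫ - h ys ≤ g x + ⟪x, A ys⟫ - h ys)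
    (α κ η : ℝ)
    (hα : α = 1 / Real.sqrt (L * μ)) (hκ : κ = L / μ)
    (hη : η = ((Real.sqrt κ - 1) / (Real.sqrt κ + 1)) ^ 2)
    (zs : EuclideanSpace ℝ (Fin dx)) (ws : EuclideanSpace ℝ (Fin dy))
    (hzs : zs = xs - α • A ys) (hws : ws = ys + α • (ContinuousLinearMap.adjoint A) xs)
    (x z xt : ℕ → EuclideanSpace ℝ (Fin dx)) (y w yt : ℕ → EuclideanSpace ℝ (Fin dy))
    (hz : ∀ k : ℕ, z (k + 1) = x k - α • A (y k))
    (hw : ∀ k : ℕ, w (k + 1) = y k + α • (ContinuousLinearMap.adjoint A) (x k))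
    (hxt : ∀ (k : ℕ) (u : EuclideanSpace ℝ (Fin dx)),
      α * g (xt (k + 1)) + 1 / 2 * ‖xt (k + 1) - z (k + 1)‖ ^ 2 ≤
        α * g u + 1 / 2 * ‖u - z (k + 1)‖ ^ 2)
    (hyt : ∀ (k : ℕ) (v : EuclideanSpace ℝ (Fin dy)),
      α * h (yt (k + 1)) + 1 / 2 * ‖yt (k + 1) - w (k + 1)‖ ^ 2 ≤
        α * h v + 1 / 2 * ‖v - w (k + 1)‖ ^ 2)
    (hxk : ∀ k : ℕ, x (k + 1) + α • A (y (k + 1)) = (2 : ℝ) • xt (k + 1) - z (k + 1))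
    (hyk : ∀ k : ℕ,
      y (k + 1) - α • (ContinuousLinearMap.adjoint A) (x (k + 1)) = (2 : ℝ) • yt (k + 1) - w (k + 1)) :
    ∀ k : ℕ, 1 ≤ k →
      ‖z (k + 1) - zs‖ ^ 2 + ‖w (k + 1) - ws‖ ^ 2 ≤
        η * (‖z k - zs‖ ^ 2 + ‖w k - ws‖ ^ 2) := by
  intro k hk
  obtain ⟨n, rfl⟩ := Nat.exists_eq_succ_of_ne_zero (Nat.one_le_iff_ne_zero.1 hk)
  simp only [Nat.succ_eq_add_one]
  have hgs : g' xs + A ys = 0 := by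
    have := (hgdiff xs).smul_add_eq_zero_of_forall_le (a := 1) (b := 0) (c := A ys) (z := 0)
      fun u => by linarith [(hsaddle u ys).2]
    simpa using this
  have hhs : h' ys - ContinuousLinearMap.adjoint A xs = 0 := by
    have := (hhdiff ys).smul_add_eq_zero_of_forall_le (a := 1) (b := 0)
      (c := -ContinuousLinearMap.adjoint A xs) (z := 0) fun v => by
        simp only [inner_neg_right, ContinuousLinearMap.adjoint_inner_right]
        rw [real_inner_comm xs, real_inner_comm xs]
        linarith [(hsaddle xs v).1]
    simpa [sub_eq_add_neg] using this
  have hgp : α • g' (xt (n + 1)) + (xt (n + 1) - z (n + 1)) = 0 := by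
    have := (hgdiff (xt (n + 1))).smul_add_eq_zero_of_forall_le (a := α) (b := 1 / 2) (c := 0)
      (z := z (n + 1)) fun u => by simpa using hxt n u
    simpa using this
  have hhp : α • h' (yt (n + 1)) + (yt (n + 1) - w (n + 1)) = 0 := by
    have := (hhdiff (yt (n + 1))).smul_add_eq_zero_of_forall_le (a := α) (b := 1 / 2) (c := 0)
      (z := w (n + 1)) fun v => by simpa using hyt n v
    simpa using this
  have hA : A ys = -g' xs := (neg_eq_of_add_eq_zero_right hgs).symm
  have hAt : ContinuousLinearMap.adjoint A xs = h' ys := (sub_eq_zero.1 hhs).symm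
  have hzn : z (n + 1) = xt (n + 1) + α • g' (xt (n + 1)) := by
    rw [← sub_eq_zero, ← neg_eq_zero, ← hgp]; abel
  have hwn : w (n + 1) = yt (n + 1) + α • h' (yt (n + 1)) := by
    rw [← sub_eq_zero, ← neg_eq_zero, ← hhp]; abel
  have hgc := norm_sq_reflected_prox_sub_le hμ hμL hgdiff hgsmooth hgsc (xt (n + 1)) xs
  have hhc := norm_sq_reflected_prox_sub_le hμ hμL hhdiff hhsmooth hhsc (yt (n + 1)) ys
  rw [← hα, ← hκ, ← hη] at hgc hhc
  have hrot := norm_sq_sub_add_norm_sq_add_adjoint A α (x (n + 1) - xs) (y (n + 1) - ys)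
  have e1 : x (n + 1) - xs - α • A (y (n + 1) - ys) = z (n + 1 + 1) - zs := by
    rw [hz, hzs, map_sub]; module
  have e2 : y (n + 1) - ys + α • ContinuousLinearMap.adjoint A (x (n + 1) - xs)
      = w (n + 1 + 1) - ws := by
    rw [hw, hws, map_sub]; module
  have e3 : x (n + 1) - xs + α • A (y (n + 1) - ys)
      = (xt (n + 1) - xs) - α • (g' (xt (n + 1)) - g' xs) := by
    have : x (n + 1) - xs + α • A (y (n + 1) - ys)
        = (x (n + 1) + α • A (y (n + 1))) - (xs + α • A ys) := by rw [map_sub]; module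
    rw [this, hxk, hzn, hA]; module
  have e4 : y (n + 1) - ys - α • ContinuousLinearMap.adjoint A (x (n + 1) - xs)
      = (yt (n + 1) - ys) - α • (h' (yt (n + 1)) - h' ys) := by
    have : y (n + 1) - ys - α • ContinuousLinearMap.adjoint A (x (n + 1) - xs)
        = (y (n + 1) - α • ContinuousLinearMap.adjoint A (x (n + 1)))
          - (ys - α • ContinuousLinearMap.adjoint A xs) := by rw [map_sub]; module
    rw [this, hyk, hwn, hAt]; module
  have e5 : (xt (n + 1) - xs) + α • (g' (xt (n + 1)) - g' xs) = z (n + 1) - zs := by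
    rw [hzn, hzs, hA]; module
  have e6 : (yt (n + 1) - ys) + α • (h' (yt (n + 1)) - h' ys) = w (n + 1) - ws := by
    rw [hwn, hws, hAt]; module
  rw [e1, e2, e3, e4] at hrot
  rw [e5] at hgc
  rw [e6] at hhc
  linarith
end

section
/- Let E be a real inner product space and g : E → ℝ be differentiable, L-smooth and μ-strongly convex with 0 < μ ≤ L. Set α = 1/√(Lμ), κ = L/μ and η = ((√κ − 1)/(√κ + 1))². Then for all x₁, x₂ ∈ E: ‖(x₁ − x₂) − α(∇g(x₁) − ∇g(x₂))‖² ≤ η·‖(x₁ − x₂) + α(∇g(x₁) − ∇g(x₂))‖². -/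
open scoped RealInnerProductSpace

/-- The quadratic upper bound (descent lemma) for a function with `L`-Lipschitz gradient. -/
theorem le_add_inner_add_sq_of_lipschitz_gradient {E : Type*} [NormedAddCommGroup E]
    [InnerProductSpace ℝ E] {g : E → ℝ} {g' : E → E} {L : ℝ}
    (hdiff : ∀ x, HasFDerivAt g (InnerProductSpace.toDualMap ℝ E (g' x)) x)
    (hsmooth : ∀ x₁ x₂ : E, ‖g' x₁ - g' x₂‖ ≤ L * ‖x₁ - x₂‖) (x v : E) :
    g (x + v) ≤ g x + ⟪g' x, v⟫ + L / 2 * ‖v‖ ^ 2 := by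
  have hd : ∀ t : ℝ, HasDerivAt
      (fun t : ℝ => g (x + t • v) - t * ⟪g' x, v⟫ - L / 2 * ‖v‖ ^ 2 * t ^ 2)
      (⟪g' (x + t • v), v⟫ - ⟪g' x, v⟫ - L * ‖v‖ ^ 2 * t) t := by
    intro t
    have hline : HasDerivAt (fun t : ℝ => x + t • v) v t := by
      simpa using ((hasDerivAt_id t).smul_const v).const_add x
    have hg : HasDerivAt (fun t : ℝ => g (x + t • v)) ⟪g' (x + t • v), v⟫ t := by
      have h := (hdiff (x + t • v)).comp_hasDerivAt t hline
      rwa [InnerProductSpace.toDualMap_apply_apply] at h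
    refine ((hg.sub ((hasDerivAt_id t).mul_const ⟪g' x, v⟫)).sub
      ((hasDerivAt_pow 2 t).const_mul (L / 2 * ‖v‖ ^ 2))).congr_deriv ?_
    norm_num
    ring
  have hanti := antitoneOn_of_hasDerivWithinAt_nonpos (convex_Icc (0 : ℝ) 1)
    (fun t _ => (hd t).continuousAt.continuousWithinAt)
    (fun t _ => (hd t).hasDerivWithinAt) (fun t ht => by
      rw [interior_Icc] at ht
      have h₁ : ⟪g' (x + t • v) - g' x, v⟫ ≤ ‖g' (x + t • v) - g' x‖ * ‖v‖ :=
        real_inner_le_norm _ _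
      have h₂ : ‖g' (x + t • v) - g' x‖ ≤ L * (t * ‖v‖) := by
        simpa [norm_smul, abs_of_pos ht.1] using hsmooth (x + t • v) x
      have h₃ := mul_le_mul_of_nonneg_right h₂ (norm_nonneg v)
      rw [inner_sub_left] at h₁
      linarith)
  have h := hanti (by simp) (by simp) zero_le_one
  simp at h
  linarith

/-- The interpolation inequality for smooth strongly convex functions. -/
theorem add_inner_add_sq_le_of_smooth_stronglyConvex {E : Type*} [NormedAddCommGroup E]
    [InnerProductSpace ℝ E] {g : E → ℝ} {g' : E → E} {L μ : ℝ} (hμL : μ < L)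
    (hdiff : ∀ x, HasFDerivAt g (InnerProductSpace.toDualMap ℝ E (g' x)) x)
    (hsmooth : ∀ x₁ x₂ : E, ‖g' x₁ - g' x₂‖ ≤ L * ‖x₁ - x₂‖)
    (hsc : ∀ x₁ x₂ : E, g x₂ ≥ g x₁ + ⟪g' x₁, x₂ - x₁⟫ + μ / 2 * ‖x₂ - x₁‖ ^ 2) (x y : E) :
    g x + ⟪g' x, y - x⟫ + μ / 2 * ‖y - x‖ ^ 2
      + 1 / (2 * (L - μ)) * ‖g' x - g' y + μ • (y - x)‖ ^ 2 ≤ g y := by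
  have hpos : 0 < L - μ := sub_pos.2 hμL
  set w := g' x - g' y + μ • (y - x) with hw
  set c := 1 / (L - μ) with hc
  have hcL : c * (L - μ) = 1 := by rw [hc]; field_simp
  have hlow := hsc x (y + c • w)
  have hup := le_add_inner_add_sq_of_lipschitz_gradient hdiff hsmooth y (c • w)
  have hww : ‖w‖ ^ 2 = ⟪g' x, w⟫ - ⟪g' y, w⟫ + μ * ⟪y - x, w⟫ := by
    rw [← real_inner_self_eq_norm_sq]
    nth_rewrite 1 [hw]
    rw [inner_add_left, inner_sub_left, real_inner_smul_left]
  have hcw : ‖c • w‖ ^ 2 = c ^ 2 * ‖w‖ ^ 2 := by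
    rw [norm_smul, mul_pow, Real.norm_eq_abs, sq_abs]
  rw [add_sub_right_comm, inner_add_right, norm_add_sq_real, hcw, real_inner_smul_right,
    real_inner_smul_right] at hlow
  rw [hcw, real_inner_smul_right] at hup
  have hhalf : 1 / (2 * (L - μ)) = c / 2 := by rw [hc]; field_simp
  rw [hhalf]
  linear_combination hlow + hup + c * hww + c / 2 * ‖w‖ ^ 2 * hcL

/-- Strengthened coercivity of the gradient of a smooth strongly convex function. -/
theorem mul_sq_add_sq_le_inner_of_smooth_stronglyConvex {E : Type*} [NormedAddCommGroup E]
    [InnerProductSpace ℝ E] {g : E → ℝ} {g' : E → E} {L μ : ℝ} (hμ : 0 ≤ μ) (hμL : μ ≤ L)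
    (hdiff : ∀ x, HasFDerivAt g (InnerProductSpace.toDualMap ℝ E (g' x)) x)
    (hsmooth : ∀ x₁ x₂ : E, ‖g' x₁ - g' x₂‖ ≤ L * ‖x₁ - x₂‖)
    (hsc : ∀ x₁ x₂ : E, g x₂ ≥ g x₁ + ⟪g' x₁, x₂ - x₁⟫ + μ / 2 * ‖x₂ - x₁‖ ^ 2) (x y : E) :
    L * μ * ‖x - y‖ ^ 2 + ‖g' x - g' y‖ ^ 2 ≤ (L + μ) * ⟪x - y, g' x - g' y⟫ := by
  have hsub : ⟪g' x, y - x⟫ + ⟪g' y, x - y⟫ = -⟪x - y, g' x - g' y⟫ := by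
    rw [← neg_sub x y, inner_neg_right, real_inner_comm (g' x - g' y), inner_sub_left]
    ring
  rcases hμL.eq_or_lt with rfl | hlt
  · have h₁ := hsc x y
    have h₂ := hsc y x
    rw [norm_sub_rev y x] at h₁
    have h₃ := pow_le_pow_left₀ (norm_nonneg _) (hsmooth x y) 2
    have h₄ : μ * ‖x - y‖ ^ 2 ≤ ⟪x - y, g' x - g' y⟫ := by linarith
    nlinarith [mul_le_mul_of_nonneg_left h₄ hμ]
  · have h₁ := add_inner_add_sq_le_of_smooth_stronglyConvex hlt hdiff hsmooth hsc x y
    have h₂ := add_inner_add_sq_le_of_smooth_stronglyConvex hlt hdiff hsmooth hsc y x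
    have hpos : 0 < L - μ := sub_pos.2 hlt
    have hneg : g' x - g' y + μ • (y - x) = -(g' y - g' x + μ • (x - y)) := by module
    have hexp : ‖g' y - g' x + μ • (x - y)‖ ^ 2
        = ‖g' x - g' y‖ ^ 2 - 2 * μ * ⟪x - y, g' x - g' y⟫ + μ ^ 2 * ‖x - y‖ ^ 2 := by
      rw [← neg_sub (g' x) (g' y), norm_add_sq_real, norm_neg, inner_neg_left,
        real_inner_smul_right, real_inner_comm (x - y), norm_smul, mul_pow, Real.norm_eq_abs,
        sq_abs]
      ring
    rw [hneg, norm_neg, norm_sub_rev y x, hexp] at h₁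
    rw [hexp] at h₂
    set N := ‖g' x - g' y‖ ^ 2 - 2 * μ * ⟪x - y, g' x - g' y⟫ + μ ^ 2 * ‖x - y‖ ^ 2
    have h₃ : N / (L - μ) ≤ ⟪x - y, g' x - g' y⟫ - μ * ‖x - y‖ ^ 2 := by
      have : N / (L - μ) = 2 * (1 / (2 * (L - μ)) * N) := by field_simp
      linarith
    rw [div_le_iff₀ hpos] at h₃
    linarith

/-- For `g : E → ℝ` differentiable, `L`-smooth and `μ`-strongly convex
(`0 < μ ≤ L`), with `α = 1/√(Lμ)`, `κ = L/μ`, `η = ((√κ − 1)/(√κ + 1))²`, one has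
`‖(x₁ − x₂) − α(∇g(x₁) − ∇g(x₂))‖² ≤ η‖(x₁ − x₂) + α(∇g(x₁) − ∇g(x₂))‖²`. -/
theorem stmt_7 {E : Type*} [NormedAddCommGroup E] [InnerProductSpace ℝ E]
    (g : E → ℝ) (g' : E → E) (L μ : ℝ) (hμ : 0 < μ) (hμL : μ ≤ L)
    (hdiff : ∀ x, HasFDerivAt g (InnerProductSpace.toDualMap ℝ E (g' x)) x)
    (hsmooth : ∀ x₁ x₂ : E, ‖g' x₁ - g' x₂‖ ≤ L * ‖x₁ - x₂‖)
    (hsc : ∀ x₁ x₂ : E, g x₂ ≥ g x₁ + ⟪g' x₁, x₂ - x₁⟫ + μ / 2 * ‖x₂ - x₁‖ ^ 2)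
    (α κ η : ℝ)
    (hα : α = 1 / Real.sqrt (L * μ)) (hκ : κ = L / μ)
    (hη : η = ((Real.sqrt κ - 1) / (Real.sqrt κ + 1)) ^ 2)
    (x₁ x₂ : E) :
    ‖(x₁ - x₂) - α • (g' x₁ - g' x₂)‖ ^ 2 ≤ η * ‖(x₁ - x₂) + α • (g' x₁ - g' x₂)‖ ^ 2 := by
  have hL : 0 < L := hμ.trans_le hμL
  have hmain := mul_sq_add_sq_le_inner_of_smooth_stronglyConvex hμ.le hμL hdiff hsmooth hsc x₁ x₂
  have hαs : ‖α • (g' x₁ - g' x₂)‖ ^ 2 = α ^ 2 * ‖g' x₁ - g' x₂‖ ^ 2 := by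
    rw [norm_smul, mul_pow, Real.norm_eq_abs, sq_abs]
  rw [norm_sub_sq_real, norm_add_sq_real, hαs, real_inner_smul_right]
  rw [Real.sqrt_mul hL.le] at hα
  rw [hκ, Real.sqrt_div hL.le] at hη
  obtain ⟨p, hp, rfl⟩ : ∃ p, 0 < p ∧ p ^ 2 = L := ⟨√L, Real.sqrt_pos.2 hL, Real.sq_sqrt hL.le⟩
  obtain ⟨q, hq, rfl⟩ : ∃ q, 0 < q ∧ q ^ 2 = μ := ⟨√μ, Real.sqrt_pos.2 hμ, Real.sq_sqrt hμ.le⟩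
  rw [Real.sqrt_sq hp.le, Real.sqrt_sq hq.le] at hα hη
  have hη' : η = ((p - q) / (p + q)) ^ 2 := by rw [hη]; field_simp
  rw [hη', hα, ← sub_nonneg]
  generalize ‖x₁ - x₂‖ ^ 2 = A at *
  generalize ‖g' x₁ - g' x₂‖ ^ 2 = B at *
  generalize ⟪x₁ - x₂, g' x₁ - g' x₂⟫ = C at *
  have hid : ((p - q) / (p + q)) ^ 2 * (A + 2 * (1 / (p * q) * C) + (1 / (p * q)) ^ 2 * B)
      - (A - 2 * (1 / (p * q) * C) + (1 / (p * q)) ^ 2 * B)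
      = 4 / ((p * q) * (p + q) ^ 2) * ((p ^ 2 + q ^ 2) * C - (p ^ 2 * q ^ 2 * A + B)) := by
    field_simp
    ring
  rw [hid]
  exact mul_nonneg (by positivity) (sub_nonneg.2 hmain)
end

section
/- (Linear convergence of DPPA.) In the setting of the DPPA contraction theorem — g, h differentiable, L-smooth, μ-strongly convex with 0 < μ ≤ L, α = 1/√(Lμ), κ = L/μ, (x*, y*) the saddle point of f(x,y) = g(x) + ⟨x, Ay⟩ − h(y), and iterates z_k = x_{k−1} − αAy_{k−1}, w_k = y_{k−1} + αA^T x_{k−1}, x̃_k = argmin_x αg(x) + (1/2)‖x − z_k‖², ỹ_k = argmin_y αh(y) + (1/2)‖y − w_k‖², x_k + αAy_k = 2x̃_k − z_k, y_k − αA^T x_k = 2ỹ_k − w_k — the iterates satisfy, for every K ≥ 1: ‖x_K − x*‖² + ‖y_K − y*‖² ≤ ((‖A‖² + Lμ)/(Lμ))·(‖x₀ − x*‖² + ‖y₀ − y*‖²)·exp(−2K/√κ). -/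
open scoped RealInnerProductSpace

section Gradient

variable {E : Type*} [NormedAddCommGroup E] [InnerProductSpace ℝ E] [CompleteSpace E]

/-- The descent lemma for a function with Lipschitz gradient. -/
theorem le_quadratic_of_lipschitz_gradient_s8 {g : E → ℝ} {g' : E → E} {L : ℝ}
    (hg : ∀ u, HasGradientAt g (g' u) u)
    (hL : ∀ u₁ u₂, ‖g' u₁ - g' u₂‖ ≤ L * ‖u₁ - u₂‖) (u v : E) :
    g v ≤ g u + ⟪g' u, v - u⟫ + L / 2 * ‖v - u‖ ^ 2 := by
  set d := v - u with hd
  have hline : ∀ t : ℝ, HasDerivAt (fun s : ℝ => u + s • d) d t := fun t => by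
    simpa using ((hasDerivAt_id t).smul_const d).const_add u
  have hderiv : ∀ t : ℝ, HasDerivAt
      (fun t : ℝ => g (u + t • d) - t * ⟪g' u, d⟫ - L / 2 * ‖d‖ ^ 2 * t ^ 2)
      (⟪g' (u + t • d), d⟫ - ⟪g' u, d⟫ - L * ‖d‖ ^ 2 * t) t := fun t => by
    have h1 : HasDerivAt (fun t : ℝ => g (u + t • d)) ⟪g' (u + t • d), d⟫ t := by
      simpa [Function.comp_def] using (hg (u + t • d)).hasFDerivAt.comp_hasDerivAt t (hline t)
    have h2 := (hasDerivAt_id t).mul_const ⟪g' u, d⟫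
    have h3 := (hasDerivAt_pow 2 t).const_mul (L / 2 * ‖d‖ ^ 2)
    refine ((h1.sub h2).sub h3).congr_deriv ?_
    push_cast
    ring
  have hanti := antitoneOn_of_deriv_nonpos (convex_Icc (0 : ℝ) 1)
    (fun t _ => (hderiv t).continuousAt.continuousWithinAt)
    (fun t _ => (hderiv t).differentiableAt.differentiableWithinAt) (fun t ht => by
      rw [interior_Icc] at ht
      rw [(hderiv t).deriv, ← inner_sub_left]
      have h1 := real_inner_le_norm (g' (u + t • d) - g' u) d
      have h2 := hL (u + t • d) u
      rw [add_sub_cancel_left, norm_smul, Real.norm_of_nonneg ht.1.le] at h2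
      nlinarith [mul_le_mul_of_nonneg_right h2 (norm_nonneg d)])
  have h01 := hanti (Set.left_mem_Icc.2 zero_le_one) (Set.right_mem_Icc.2 zero_le_one) zero_le_one
  simp only [one_smul, zero_smul, add_zero, hd, add_sub_cancel] at h01 ⊢
  linarith

/-- The interpolation inequality for smooth and strongly convex functions. -/
theorem inner_gradient_interpolation {g : E → ℝ} {g' : E → E} {L μ : ℝ} (hμL : μ ≤ L)
    (hg : ∀ u, HasGradientAt g (g' u) u)
    (hL : ∀ u₁ u₂, ‖g' u₁ - g' u₂‖ ≤ L * ‖u₁ - u₂‖)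
    (hsc : ∀ u₁ u₂, g u₂ ≥ g u₁ + ⟪g' u₁, u₂ - u₁⟫ + μ / 2 * ‖u₂ - u₁‖ ^ 2) (u v : E) :
    ‖g' u - g' v‖ ^ 2 + L * μ * ‖u - v‖ ^ 2 ≤ (L + μ) * ⟪g' u - g' v, u - v⟫ := by
  rcases hμL.eq_or_lt with rfl | hlt
  · have h1 := hsc u v
    have h2 := hsc v u
    have h3 := hL u v
    have h4 : μ * ‖u - v‖ ^ 2 ≤ ⟪g' u - g' v, u - v⟫ := by
      rw [← neg_sub u v, norm_neg, inner_neg_right] at h1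
      rw [inner_sub_left]
      linarith
    have h5 : ‖g' u - g' v‖ ^ 2 ≤ (μ * ‖u - v‖) ^ 2 := pow_le_pow_left₀ (norm_nonneg _) h3 2
    by_cases huv : u = v
    · simp [huv]
    have hpos : 0 < ‖u - v‖ := norm_pos_iff.2 (sub_ne_zero.2 huv)
    have hμ : 0 ≤ μ := nonneg_of_mul_nonneg_left ((norm_nonneg _).trans h3) hpos
    nlinarith [mul_le_mul_of_nonneg_left h4 hμ]
  · have hD : 0 < L - μ := sub_pos.2 hlt
    have key : ∀ a b : E, ∀ t : ℝ,
        g a - g b + ⟪g' a, b - a⟫ + μ / 2 * ‖b - a‖ ^ 2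
          + t * ‖g' a - g' b - μ • (a - b)‖ ^ 2
          - (L - μ) / 2 * t ^ 2 * ‖g' a - g' b - μ • (a - b)‖ ^ 2 ≤ 0 := fun a b t => by
      set d := g' a - g' b - μ • (a - b) with hd
      have h1 := hsc a (b + t • d)
      have h2 := le_quadratic_of_lipschitz_gradient_s8 hg hL b (b + t • d)
      have h3 : b + t • d - a = (b - a) + t • d := by abel
      rw [h3, norm_add_sq_real, inner_add_right] at h1
      rw [add_sub_cancel_left] at h2
      simp only [inner_smul_right, norm_smul, mul_pow, Real.norm_eq_abs, sq_abs] at h1 h2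
      have h4 : ‖d‖ ^ 2 = ⟪g' a, d⟫ - ⟪g' b, d⟫ + μ * ⟪b - a, d⟫ := by
        rw [← real_inner_self_eq_norm_sq]
        nth_rewrite 1 [hd]
        rw [inner_sub_left, inner_sub_left, real_inner_smul_left, ← neg_sub b a, inner_neg_left]
        ring
      have h5 : t * ‖d‖ ^ 2 = t * (⟪g' a, d⟫ - ⟪g' b, d⟫ + μ * ⟪b - a, d⟫) := by rw [h4]
      linarith
    have h1 := key u v (1 / (L - μ))
    have h2 := key v u (1 / (L - μ))
    have h6 : g' v - g' u - μ • (v - u) = -(g' u - g' v - μ • (u - v)) := by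
      rw [← neg_sub u v, smul_neg]; abel
    rw [h6, norm_neg] at h2
    have h7 : ‖g' u - g' v - μ • (u - v)‖ ^ 2
        = ‖g' u - g' v‖ ^ 2 - 2 * μ * ⟪g' u - g' v, u - v⟫ + μ ^ 2 * ‖u - v‖ ^ 2 := by
      rw [norm_sub_sq_real, real_inner_smul_right, norm_smul, mul_pow, Real.norm_eq_abs, sq_abs]
      ring
    rw [← neg_sub u v, norm_neg, inner_neg_right] at h1
    have h8 : ⟪g' u - g' v, u - v⟫ = ⟪g' u, u - v⟫ - ⟪g' v, u - v⟫ := inner_sub_left _ _ _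
    set N := ‖g' u - g' v - μ • (u - v)‖ ^ 2 with hN
    have h9 : 1 / (L - μ) * N ≤ ⟪g' u - g' v, u - v⟫ - μ * ‖u - v‖ ^ 2 := by
      have : (L - μ) / 2 * (1 / (L - μ)) ^ 2 * N = 1 / (L - μ) * N / 2 := by
        field_simp
      linarith
    rw [one_div_mul_eq_div, div_le_iff₀ hD] at h9
    linarith

/-- First-order optimality for the sum of a differentiable and a linear function. -/
theorem gradient_add_eq_zero_of_forall_le {g : E → ℝ} {d p b : E} (hg : HasGradientAt g d p)
    (hmin : ∀ u, g p + ⟪b, p⟫ ≤ g u + ⟪b, u⟫) : d + b = 0 := by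
  have hloc : IsLocalMin (fun u => g u + ⟪b, u⟫) p := Filter.Eventually.of_forall hmin
  have hder := hloc.hasFDerivAt_eq_zero (hg.hasFDerivAt.add (innerSL ℝ b).hasFDerivAt)
  have := congrArg (fun f : E →L[ℝ] ℝ => f (d + b)) hder
  simpa [← inner_add_left] using this

/-- First-order optimality for the proximal subproblem. -/
theorem smul_gradient_add_sub_eq_zero_of_prox {g : E → ℝ} {d p z : E} {α : ℝ}
    (hg : HasGradientAt g d p)
    (hmin : ∀ u, α * g p + 1 / 2 * ‖p - z‖ ^ 2 ≤ α * g u + 1 / 2 * ‖u - z‖ ^ 2) :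
    α • d + (p - z) = 0 := by
  have hloc : IsLocalMin (fun u => α * g u + 1 / 2 * ‖u - z‖ ^ 2) p :=
    Filter.Eventually.of_forall hmin
  have hder := hloc.hasFDerivAt_eq_zero ((hg.hasFDerivAt.const_mul α).add
    ((((hasFDerivAt_id p).sub_const z).norm_sq).const_mul (1 / 2)))
  have := congrArg (fun f : E →L[ℝ] ℝ => f (α • d + (p - z))) hder
  rw [← inner_self_eq_zero (𝕜 := ℝ), inner_add_left, real_inner_smul_left]
  simpa [inner_sub_left] using this

/-- The reflected gradient step contracts at the optimal step size. -/
theorem norm_reflected_prox_sq_le {g : E → ℝ} {g' : E → E} {L μ α : ℝ} (hμL : μ ≤ L)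
    (hα : α ^ 2 * (L * μ) = 1) (hg : ∀ u, HasGradientAt g (g' u) u)
    (hL : ∀ u₁ u₂, ‖g' u₁ - g' u₂‖ ≤ L * ‖u₁ - u₂‖)
    (hsc : ∀ u₁ u₂, g u₂ ≥ g u₁ + ⟪g' u₁, u₂ - u₁⟫ + μ / 2 * ‖u₂ - u₁‖ ^ 2)
    {u v z zs : E} (hu : α • g' u + (u - z) = 0) (hv : α • g' v + (v - zs) = 0) :
    (α * (L + μ) + 2) * ‖((2 : ℝ) • u - z) - ((2 : ℝ) • v - zs)‖ ^ 2 ≤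
      (α * (L + μ) - 2) * ‖z - zs‖ ^ 2 := by
  have hz : z = u + α • g' u := by
    rw [eq_comm, ← sub_eq_zero, ← hu]
    abel
  have hzs : zs = v + α • g' v := by
    rw [eq_comm, ← sub_eq_zero, ← hv]
    abel
  have h1 : ((2 : ℝ) • u - z) - ((2 : ℝ) • v - zs) = (u - v) - α • (g' u - g' v) := by
    rw [hz, hzs]; module
  have h2 : z - zs = (u - v) + α • (g' u - g' v) := by
    rw [hz, hzs]; module
  rw [h1, h2, norm_sub_sq_real, norm_add_sq_real, real_inner_smul_right, norm_smul, mul_pow,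
    Real.norm_eq_abs, sq_abs, real_inner_comm]
  have h3 := mul_le_mul_of_nonneg_left (inner_gradient_interpolation hμL hg hL hsc u v)
    (sq_nonneg α)
  linear_combination 4 * h3 - 4 * ‖u - v‖ ^ 2 * hα

end Gradient

/-- The rotation identity for a bounded bilinear coupling. -/
theorem norm_sq_sub_smul_add_norm_sq_add_smul {E F : Type*} [NormedAddCommGroup E]
    [InnerProductSpace ℝ E] [CompleteSpace E] [NormedAddCommGroup F] [InnerProductSpace ℝ F]
    [CompleteSpace F] (A : F →L[ℝ] E) (c : ℝ) (a : E) (b : F) :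
    ‖a - c • A b‖ ^ 2 + ‖b + c • (ContinuousLinearMap.adjoint A) a‖ ^ 2 =
      ‖a‖ ^ 2 + ‖b‖ ^ 2 + c ^ 2 * (‖A b‖ ^ 2 + ‖(ContinuousLinearMap.adjoint A) a‖ ^ 2) := by
  rw [norm_sub_sq_real, norm_add_sq_real, real_inner_smul_right, real_inner_smul_right,
    ContinuousLinearMap.adjoint_inner_right, real_inner_comm (A b) a, norm_smul, norm_smul,
    mul_pow, mul_pow, Real.norm_eq_abs, sq_abs]
  ring

/-- The contraction factor at condition number `s ^ 2` is at most `exp (-2 / s)`. -/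
theorem contraction_factor_le_exp {s : ℝ} (hs : 1 ≤ s) :
    ((s - 1) / (s + 1)) ^ 2 ≤ Real.exp (-2 / s) := by
  have hpos : 0 < s := by linarith
  have h1 : (s - 1) / (s + 1) ≤ Real.exp (-1 / s) := by
    refine le_trans ?_ (Real.add_one_le_exp _)
    rw [div_add_one hpos.ne', div_le_div_iff₀ (by linarith) hpos]
    nlinarith
  have h2 : Real.exp (-2 / s) = Real.exp (-1 / s) ^ 2 := by
    rw [← Real.exp_nat_mul]
    congr 1
    push_cast
    ring
  rw [h2]
  exact pow_le_pow_left₀ (div_nonneg (by linarith) (by linarith)) h1 2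

/-- linear convergence of DPPA.
In the setting of the DPPA contraction theorem, the iterates satisfy, for every `K ≥ 1`,
`‖x_K − x*‖² + ‖y_K − y*‖² ≤ ((‖A‖² + Lμ)/(Lμ))(‖x₀ − x*‖² + ‖y₀ − y*‖²) exp(−2K/√κ)`. -/
theorem stmt_8 {dx dy : ℕ}
    (g : EuclideanSpace ℝ (Fin dx) → ℝ) (h : EuclideanSpace ℝ (Fin dy) → ℝ)
    (g' : EuclideanSpace ℝ (Fin dx) → EuclideanSpace ℝ (Fin dx))
    (h' : EuclideanSpace ℝ (Fin dy) → EuclideanSpace ℝ (Fin dy))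
    (L μ : ℝ) (hμ : 0 < μ) (hμL : μ ≤ L)
    (hgdiff : ∀ u, HasGradientAt g (g' u) u) (hhdiff : ∀ v, HasGradientAt h (h' v) v)
    (hgsmooth : ∀ u₁ u₂, ‖g' u₁ - g' u₂‖ ≤ L * ‖u₁ - u₂‖)
    (hhsmooth : ∀ v₁ v₂, ‖h' v₁ - h' v₂‖ ≤ L * ‖v₁ - v₂‖)
    (hgsc : ∀ u₁ u₂, g u₂ ≥ g u₁ + ⟪g' u₁, u₂ - u₁⟫ + μ / 2 * ‖u₂ - u₁‖ ^ 2)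
    (hhsc : ∀ v₁ v₂, h v₂ ≥ h v₁ + ⟪h' v₁, v₂ - v₁⟫ + μ / 2 * ‖v₂ - v₁‖ ^ 2)
    (A : EuclideanSpace ℝ (Fin dy) →L[ℝ] EuclideanSpace ℝ (Fin dx))
    (xs : EuclideanSpace ℝ (Fin dx)) (ys : EuclideanSpace ℝ (Fin dy))
    (hsaddle : ∀ (x : EuclideanSpace ℝ (Fin dx)) (y : EuclideanSpace ℝ (Fin dy)),
      g xs + ⟪xs, A y⟫ - h y ≤ g xs + ⟪xs, A ys⟫ - h ys ∧
      g xs + ⟪xs, A ys⟫ - h ys ≤ g x + ⟪x, A ys⟫ - h ys)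
    (α κ : ℝ)
    (hα : α = 1 / Real.sqrt (L * μ)) (hκ : κ = L / μ)
    (zs : EuclideanSpace ℝ (Fin dx)) (ws : EuclideanSpace ℝ (Fin dy))
    (hzs : zs = xs - α • A ys) (hws : ws = ys + α • (ContinuousLinearMap.adjoint A) xs)
    (x z xt : ℕ → EuclideanSpace ℝ (Fin dx)) (y w yt : ℕ → EuclideanSpace ℝ (Fin dy))
    (hz : ∀ k : ℕ, z (k + 1) = x k - α • A (y k))
    (hw : ∀ k : ℕ, w (k + 1) = y k + α • (ContinuousLinearMap.adjoint A) (x k))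
    (hxt : ∀ (k : ℕ) (u : EuclideanSpace ℝ (Fin dx)),
      α * g (xt (k + 1)) + 1 / 2 * ‖xt (k + 1) - z (k + 1)‖ ^ 2 ≤
        α * g u + 1 / 2 * ‖u - z (k + 1)‖ ^ 2)
    (hyt : ∀ (k : ℕ) (v : EuclideanSpace ℝ (Fin dy)),
      α * h (yt (k + 1)) + 1 / 2 * ‖yt (k + 1) - w (k + 1)‖ ^ 2 ≤
        α * h v + 1 / 2 * ‖v - w (k + 1)‖ ^ 2)
    (hxk : ∀ k : ℕ, x (k + 1) + α • A (y (k + 1)) = (2 : ℝ) • xt (k + 1) - z (k + 1))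
    (hyk : ∀ k : ℕ,
      y (k + 1) - α • (ContinuousLinearMap.adjoint A) (x (k + 1)) = (2 : ℝ) • yt (k + 1) - w (k + 1)) :
    ∀ K : ℕ, 1 ≤ K →
      ‖x K - xs‖ ^ 2 + ‖y K - ys‖ ^ 2 ≤
        (‖A‖ ^ 2 + L * μ) / (L * μ) * (‖x 0 - xs‖ ^ 2 + ‖y 0 - ys‖ ^ 2) *
          Real.exp (-(2 * K) / Real.sqrt κ) := by
  have hLpos : 0 < L := hμ.trans_le hμL
  have hLμ : 0 < L * μ := mul_pos hLpos hμ
  have hα2 : α ^ 2 * (L * μ) = 1 := by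
    rw [hα, div_pow, Real.sq_sqrt hLμ.le]
    field_simp
  set s := Real.sqrt κ with hs
  have hs1 : 1 ≤ s := by
    rw [hs, Real.one_le_sqrt, hκ, one_le_div hμ]
    exact hμL
  have hm : α * (L + μ) = s + 1 / s := by
    rw [hα, hs, hκ, Real.sqrt_div hLpos.le, Real.sqrt_mul hLpos.le]
    have hL0 := (Real.sqrt_pos.2 hLpos).ne'
    have hμ0 := (Real.sqrt_pos.2 hμ).ne'
    field_simp
    rw [Real.sq_sqrt hLpos.le, Real.sq_sqrt hμ.le]
  have hgs : g' xs + A ys = 0 := gradient_add_eq_zero_of_forall_le (hgdiff xs) fun u => by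
    have := (hsaddle u ys).2
    rw [real_inner_comm, real_inner_comm _ (A ys)]
    linarith
  have hhs : h' ys + -(ContinuousLinearMap.adjoint A) xs = 0 :=
    gradient_add_eq_zero_of_forall_le (hhdiff ys) fun v => by
      have := (hsaddle xs v).1
      rw [inner_neg_left, inner_neg_left, ContinuousLinearMap.adjoint_inner_left,
        ContinuousLinearMap.adjoint_inner_left]
      linarith
  have hzs' : α • g' xs + (xs - zs) = 0 := by
    rw [hzs, sub_sub_cancel, ← smul_add, hgs, smul_zero]
  have hws' : α • h' ys + (ys - ws) = 0 := by
    rw [hws, sub_add_cancel_left, ← smul_neg, ← smul_add, hhs, smul_zero]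
  set V : ℕ → ℝ := fun k => ‖z (k + 1) - zs‖ ^ 2 + ‖w (k + 1) - ws‖ ^ 2 with hV
  have hVeq : ∀ k, V k = ‖x k - xs‖ ^ 2 + ‖y k - ys‖ ^ 2 + α ^ 2 *
      (‖A (y k - ys)‖ ^ 2 + ‖(ContinuousLinearMap.adjoint A) (x k - xs)‖ ^ 2) := fun k => by
    rw [← norm_sq_sub_smul_add_norm_sq_add_smul]
    simp only [hV, hz, hw, hzs, hws, map_sub]
    congr 3
    · module
    · module
  have hVsucc : ∀ k, V (k + 1) ≤ ((s - 1) / (s + 1)) ^ 2 * V k := fun k => by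
    have h1 := norm_reflected_prox_sq_le hμL hα2 hgdiff hgsmooth hgsc
      (smul_gradient_add_sub_eq_zero_of_prox (hgdiff _) (hxt k)) hzs'
    have h2 := norm_reflected_prox_sq_le hμL hα2 hhdiff hhsmooth hhsc
      (smul_gradient_add_sub_eq_zero_of_prox (hhdiff _) (hyt k)) hws'
    have hx : (2 : ℝ) • xt (k + 1) - z (k + 1) - ((2 : ℝ) • xs - zs) =
        (x (k + 1) - xs) - (-α) • A (y (k + 1) - ys) := by
      rw [← hxk, hzs, map_sub]; module
    have hy : (2 : ℝ) • yt (k + 1) - w (k + 1) - ((2 : ℝ) • ys - ws) =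
        (y (k + 1) - ys) + (-α) • (ContinuousLinearMap.adjoint A) (x (k + 1) - xs) := by
      rw [← hyk, hws, map_sub]; module
    have h3 := norm_sq_sub_smul_add_norm_sq_add_smul A (-α) (x (k + 1) - xs) (y (k + 1) - ys)
    rw [neg_sq, ← hVeq, ← hx, ← hy] at h3
    have h4 : (s + 1 / s + 2) * V (k + 1) ≤ (s + 1 / s - 2) * V k := by
      rw [← h3, ← hm]
      simp only [hV]
      linarith
    have hpos : 0 < s := by linarith
    have h5 : s + 1 / s + 2 = (s + 1) ^ 2 / s := by field_simp; ring
    have h6 : s + 1 / s - 2 = (s - 1) ^ 2 / s := by field_simp; ring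
    rw [h5, h6, div_mul_eq_mul_div, div_mul_eq_mul_div, div_le_div_iff_of_pos_right hpos] at h4
    rw [div_pow, div_mul_eq_mul_div, le_div_iff₀ (by positivity), mul_comm]
    exact h4
  have hVK : ∀ k : ℕ, V k ≤ Real.exp (-(2 * k) / s) * V 0 := fun k => by
    induction k with
    | zero => simp
    | succ k ih =>
      have hexp : Real.exp (-(2 * (k + 1 : ℕ)) / s) =
          Real.exp (-2 / s) * Real.exp (-(2 * k) / s) := by
        rw [← Real.exp_add]
        congr 1
        push_cast
        ring
      have hVk : 0 ≤ V k := by positivity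
      calc V (k + 1) ≤ ((s - 1) / (s + 1)) ^ 2 * V k := hVsucc k
        _ ≤ Real.exp (-2 / s) * V k :=
          mul_le_mul_of_nonneg_right (contraction_factor_le_exp hs1) hVk
        _ ≤ Real.exp (-2 / s) * (Real.exp (-(2 * k) / s) * V 0) :=
          mul_le_mul_of_nonneg_left ih (Real.exp_nonneg _)
        _ = Real.exp (-(2 * (k + 1 : ℕ)) / s) * V 0 := by rw [hexp, mul_assoc]
  have hV0 : V 0 ≤ (‖A‖ ^ 2 + L * μ) / (L * μ) * (‖x 0 - xs‖ ^ 2 + ‖y 0 - ys‖ ^ 2) := by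
    have h1 := pow_le_pow_left₀ (norm_nonneg _) (A.le_opNorm (y 0 - ys)) 2
    have h2 := pow_le_pow_left₀ (norm_nonneg _)
      ((ContinuousLinearMap.adjoint A).le_opNorm (x 0 - xs)) 2
    rw [LinearIsometryEquiv.norm_map] at h2
    rw [mul_pow] at h1 h2
    have h3 := mul_le_mul_of_nonneg_left (add_le_add h1 h2) (sq_nonneg α)
    have h4 : (‖A‖ ^ 2 + L * μ) / (L * μ) = α ^ 2 * ‖A‖ ^ 2 + 1 := by
      rw [div_eq_iff hLμ.ne']
      linear_combination -‖A‖ ^ 2 * hα2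
    rw [hVeq, h4]
    linarith
  intro K _
  calc ‖x K - xs‖ ^ 2 + ‖y K - ys‖ ^ 2 ≤ V K := by
        rw [hVeq]
        exact le_add_of_nonneg_right (by positivity)
    _ ≤ Real.exp (-(2 * K) / s) * V 0 := hVK K
    _ ≤ Real.exp (-(2 * K) / s) *
        ((‖A‖ ^ 2 + L * μ) / (L * μ) * (‖x 0 - xs‖ ^ 2 + ‖y 0 - ys‖ ^ 2)) :=
      mul_le_mul_of_nonneg_left hV0 (Real.exp_nonneg _)
    _ = _ := mul_comm _ _
end

section
/- (Inner AGD complexity in DIPPA.) In the setting of the DIPPA outer-loop theorem (g, h differentiable, L-smooth, μ-strongly convex, 0 < μ ≤ L, α = 1/√(Lμ), κ = L/μ, ρ = 1/(2√κ), C₀ = ‖x₀ − x*‖² + ‖y₀ − y*‖², ε_k = (C₀μ/16)(1 − ρ)^{k+1}, C = 4√κ + 1 + ‖A‖²/(Lμ), z* = x* − αAy*, w* = y* + αA^T x*), fix k ≥ 1 and assume ‖z_k − z*‖² + ‖w_k − w*‖² ≤ C·C₀·(1 − ρ)^k. The function G_k(x) = g(x) + (1/(2α))‖x − z_k‖² is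 (L + √(Lμ))-smooth and (μ + √(Lμ))-strongly convex with condition number √κ, and running Nesterov's Accelerated Gradient Descent on G_k from the initial point x_{k−1} for K₁ = ⌊κ^{1/4}·log(32C(√L + √μ)²/(μ(1 − ρ)))⌋ + 1 iterations produces a point x̃_k with G_k(x̃_k) − min_x G_k(x) ≤ ε_k. -/
open scoped RealInnerProductSpace

section FirstOrder

variable {E : Type*} [NormedAddCommGroup E] [InnerProductSpace ℝ E]

/-- The descent lemma: a function with `ℓ`-Lipschitz gradient lies below its quadratic model. -/
theorem descent_of_lipschitz_gradient_s12 [CompleteSpace E] {φ : E → ℝ} {φ' : E → E} {ℓ : ℝ}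
    (hφ : ∀ u, HasGradientAt φ (φ' u) u)
    (hlip : ∀ u v, ‖φ' u - φ' v‖ ≤ ℓ * ‖u - v‖) (u v : E) :
    φ v ≤ φ u + ⟪φ' u, v - u⟫ + ℓ / 2 * ‖v - u‖ ^ 2 := by
  set d := v - u with hd
  have hderiv : ∀ t : ℝ, HasDerivAt
      (fun t : ℝ => φ (u + t • d) - t * ⟪φ' u, d⟫ - ℓ / 2 * t ^ 2 * ‖d‖ ^ 2)
      (⟪φ' (u + t • d), d⟫ - ⟪φ' u, d⟫ - ℓ * t * ‖d‖ ^ 2) t := by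
    intro t
    have hline : HasDerivAt (fun t : ℝ => u + t • d) d t := by
      simpa using ((hasDerivAt_id t).smul_const d).const_add u
    have hcomp := (hφ (u + t • d)).hasFDerivAt.comp_hasDerivAt t hline
    have hlin := (hasDerivAt_id t).mul_const ⟪φ' u, d⟫
    have hquad := (((hasDerivAt_id t).pow 2).const_mul (ℓ / 2)).mul_const (‖d‖ ^ 2)
    refine ((hcomp.sub hlin).sub hquad).congr_deriv ?_
    simp only [InnerProductSpace.toDual_apply_apply, id, Nat.cast_ofNat, Nat.reduceSub, pow_one]
    ring
  have hanti : AntitoneOn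
      (fun t : ℝ => φ (u + t • d) - t * ⟪φ' u, d⟫ - ℓ / 2 * t ^ 2 * ‖d‖ ^ 2) (Set.Icc 0 1) := by
    refine antitoneOn_of_deriv_nonpos (convex_Icc 0 1)
      (fun t _ => (hderiv t).continuousAt.continuousWithinAt)
      (fun t _ => (hderiv t).differentiableAt.differentiableWithinAt) fun t ht => ?_
    rw [interior_Icc] at ht
    rw [(hderiv t).deriv, ← inner_sub_left]
    have hcs := real_inner_le_norm (φ' (u + t • d) - φ' u) d
    have hl := hlip (u + t • d) u
    rw [add_sub_cancel_left, norm_smul, Real.norm_of_nonneg ht.1.le] at hl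
    nlinarith [norm_nonneg d, mul_le_mul_of_nonneg_right hl (norm_nonneg d)]
  have h01 := hanti (Set.left_mem_Icc.2 zero_le_one) (Set.right_mem_Icc.2 zero_le_one) zero_le_one
  simp only [one_smul, zero_smul, add_zero, hd, add_sub_cancel] at h01
  rw [← hd] at h01
  linarith

/-- A gradient step of length `1 / ℓ` decreases the objective by at least `‖∇φ‖² / (2ℓ)`. -/
theorem gradient_step_le {φ : E → ℝ} {φ' : E → E} {ℓ : ℝ} (hℓ : 0 < ℓ)
    (hsm : ∀ u v, φ v ≤ φ u + ⟪φ' u, v - u⟫ + ℓ / 2 * ‖v - u‖ ^ 2) (u : E) :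
    φ (u - (1 / ℓ) • φ' u) ≤ φ u - 1 / (2 * ℓ) * ‖φ' u‖ ^ 2 := by
  have h := hsm u (u - (1 / ℓ) • φ' u)
  rw [sub_sub_cancel_left, inner_neg_right, inner_smul_right, norm_neg, norm_smul, mul_pow,
    real_inner_self_eq_norm_sq, Real.norm_of_nonneg (by positivity)] at h
  refine h.trans (le_of_eq ?_)
  field_simp
  ring

theorem gradient_eq_zero_of_forall_le {φ : E → ℝ} {φ' : E → E} {ℓ : ℝ} (hℓ : 0 < ℓ)
    (hsm : ∀ u v, φ v ≤ φ u + ⟪φ' u, v - u⟫ + ℓ / 2 * ‖v - u‖ ^ 2) {u : E}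
    (hmin : ∀ v, φ u ≤ φ v) : φ' u = 0 := by
  have h := (hmin _).trans (gradient_step_le hℓ hsm u)
  have hpos : 0 < 1 / (2 * ℓ) := by positivity
  have hsq : ‖φ' u‖ ^ 2 ≤ 0 := by
    by_contra! hlt
    nlinarith [mul_pos hpos hlt]
  exact norm_eq_zero.1 (pow_eq_zero_iff two_ne_zero |>.1 (le_antisymm hsq (sq_nonneg _)))

/-- A continuous strongly convex function on a proper space attains its minimum. -/
theorem exists_forall_le_of_strongly_convex [ProperSpace E] {φ : E → ℝ} {φ' : E → E} {m : ℝ}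
    (hm : 0 < m) (hcont : Continuous φ)
    (hsc : ∀ u v, φ u + ⟪φ' u, v - u⟫ + m / 2 * ‖v - u‖ ^ 2 ≤ φ v) :
    ∃ x, ∀ v, φ x ≤ φ v := by
  have hR : 0 ≤ 2 * ‖φ' 0‖ / m := by positivity
  obtain ⟨x, -, hx⟩ := (isCompact_closedBall (0 : E) (2 * ‖φ' 0‖ / m)).exists_isMinOn
    ⟨0, Metric.mem_closedBall_self hR⟩ hcont.continuousOn
  refine ⟨x, fun v => ?_⟩
  by_cases hv : v ∈ Metric.closedBall (0 : E) (2 * ‖φ' 0‖ / m)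
  · exact hx hv
  · have h0 : φ x ≤ φ 0 := hx (Metric.mem_closedBall_self hR)
    rw [mem_closedBall_zero_iff, not_le, div_lt_iff₀ hm] at hv
    have h := hsc 0 v
    rw [sub_zero] at h
    have hcs := (abs_le.1 (abs_real_inner_le_norm (φ' 0) v)).1
    nlinarith [mul_le_mul_of_nonneg_right hv.le (norm_nonneg v)]

/-- One step of accelerated gradient descent contracts the Lyapunov function
`φ x - φ u + m / 2 * ‖y + q • (y - x) - u‖ ^ 2` by the factor `1 - 1 / q`, where `q ^ 2` is the
condition number. -/
theorem agd_lyapunov_step {φ : E → ℝ} {φ' : E → E} {m q : ℝ} (hm : 0 < m) (hq : 1 ≤ q)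
    (hsm : ∀ u v, φ v ≤ φ u + ⟪φ' u, v - u⟫ + m * q ^ 2 / 2 * ‖v - u‖ ^ 2)
    (hsc : ∀ u v, φ u + ⟪φ' u, v - u⟫ + m / 2 * ‖v - u‖ ^ 2 ≤ φ v)
    {x y x₁ y₁ : E} (u : E) (hx₁ : x₁ = y - (1 / (m * q ^ 2)) • φ' y)
    (hy₁ : y₁ = x₁ + ((q - 1) / (q + 1)) • (x₁ - x)) :
    φ x₁ - φ u + m / 2 * ‖y₁ + q • (y₁ - x₁) - u‖ ^ 2 ≤
      (1 - 1 / q) * (φ x - φ u + m / 2 * ‖y + q • (y - x) - u‖ ^ 2) := by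
  have hq0 : 0 < q := by linarith
  have hstep : φ x₁ ≤ φ y - 1 / (2 * (m * q ^ 2)) * ‖φ' y‖ ^ 2 :=
    hx₁ ▸ gradient_step_le (by positivity) hsm y
  have hxy := hsc y x
  have huy := hsc y u
  set γ := φ' y
  have hnew : y₁ + q • (y₁ - x₁) - u =
      (y - u) + (q - 1) • (y - x) - (1 / (q * m)) • γ := by
    have hc : (q - 1) / (q + 1) + q * ((q - 1) / (q + 1)) = q - 1 := by field_simp; ring
    have hy : y₁ + q • (y₁ - x₁) - u = x₁ + (q - 1) • (x₁ - x) - u := by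
      rw [← hc, hy₁]; module
    have hc' : 1 / (q * m) = 1 / (m * q ^ 2) + (q - 1) * (1 / (m * q ^ 2)) := by field_simp; ring
    rw [hy, hc', hx₁]; module
  have hold : y + q • (y - x) - u = (y - u) + q • (y - x) := by module
  rw [hnew, hold]
  rw [← neg_sub y x, inner_neg_right, norm_neg] at hxy
  rw [← neg_sub y u, inner_neg_right, norm_neg] at huy
  set p := y - x
  set r := y - u
  have hkey : m / 2 * ‖r + (q - 1) • p - (1 / (q * m)) • γ‖ ^ 2 =
      (1 - 1 / q) * (m / 2 * ‖r + q • p‖ ^ 2) + m / (2 * q) * ‖r‖ ^ 2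
        - m / 2 * (q - 1) * ‖p‖ ^ 2 + 1 / (2 * (m * q ^ 2)) * ‖γ‖ ^ 2
        - 1 / q * ⟪γ, r⟫ - (1 - 1 / q) * ⟪γ, p⟫ := by
    rw [norm_sub_sq_real, norm_add_sq_real, norm_add_sq_real, inner_add_left]
    simp only [norm_smul, inner_smul_right, mul_pow, Real.norm_eq_abs, sq_abs,
      real_inner_comm γ]
    field_simp
    ring
  have hs0 : 0 < 1 / q := by positivity
  have hs1 : 0 ≤ 1 - 1 / q := by
    rw [sub_nonneg, div_le_one hq0]; exact hq
  have hA := mul_le_mul_of_nonneg_left hxy hs1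
  have hB := mul_le_mul_of_nonneg_left huy hs0.le
  have hP : 0 ≤ m / 2 * (q - 1) * ‖p‖ ^ 2 := by
    have : 0 ≤ q - 1 := by linarith
    positivity
  have hP' : 0 ≤ (1 - 1 / q) * (m / 2 * ‖p‖ ^ 2) := by positivity
  have hr : m / (2 * q) * ‖r‖ ^ 2 = 1 / q * (m / 2 * ‖r‖ ^ 2) := by field_simp
  rw [hkey, hr]
  linarith

/-- Linear convergence of Nesterov's accelerated gradient descent to a minimizer `u`. -/
theorem agd_convergence {φ : E → ℝ} {φ' : E → E} {m q : ℝ} (hm : 0 < m) (hq : 1 ≤ q)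
    (hsm : ∀ u v, φ v ≤ φ u + ⟪φ' u, v - u⟫ + m * q ^ 2 / 2 * ‖v - u‖ ^ 2)
    (hsc : ∀ u v, φ u + ⟪φ' u, v - u⟫ + m / 2 * ‖v - u‖ ^ 2 ≤ φ v)
    {x y : ℕ → E} (h0 : y 0 = x 0)
    (hx : ∀ t, x (t + 1) = y t - (1 / (m * q ^ 2)) • φ' (y t))
    (hy : ∀ t, y (t + 1) = x (t + 1) + ((q - 1) / (q + 1)) • (x (t + 1) - x t))
    {u : E} (hu : φ' u = 0) (T : ℕ) :
    φ (x T) - φ u ≤ (m * q ^ 2 + m) / 2 * ‖x 0 - u‖ ^ 2 * Real.exp (-(T / q)) := by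
  have hq0 : 0 < q := by linarith
  have hs1 : 0 ≤ 1 - 1 / q := by
    rw [sub_nonneg, div_le_one hq0]; exact hq
  have hlyap : ∀ t : ℕ, φ (x t) - φ u + m / 2 * ‖y t + q • (y t - x t) - u‖ ^ 2 ≤
      (1 - 1 / q) ^ t * ((m * q ^ 2 + m) / 2 * ‖x 0 - u‖ ^ 2) := by
    intro t
    induction t with
    | zero =>
      have h := hsm u (x 0)
      rw [hu, inner_zero_left] at h
      simp only [h0, sub_self, smul_zero, add_zero, pow_zero, one_mul]
      linarith
    | succ t ih =>
      refine (agd_lyapunov_step hm hq hsm hsc u (hx t) (hy t)).trans ?_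
      rw [pow_succ' (1 - 1 / q), mul_assoc]
      exact mul_le_mul_of_nonneg_left ih hs1
  have hexp : (1 - 1 / q) ^ T ≤ Real.exp (-(T / q)) := by
    have h1 : 1 - 1 / q ≤ Real.exp (-(1 / q)) := by
      have := Real.add_one_le_exp (-(1 / q)); linarith
    refine (pow_le_pow_left₀ hs1 h1 T).trans (le_of_eq ?_)
    rw [← Real.exp_nat_mul]
    congr 1
    ring
  have hV : 0 ≤ m / 2 * ‖y T + q • (y T - x T) - u‖ ^ 2 := by positivity
  have hD : 0 ≤ (m * q ^ 2 + m) / 2 * ‖x 0 - u‖ ^ 2 := by positivity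
  have := mul_le_mul_of_nonneg_right hexp hD
  linarith [hlyap T]

/-- Expansion of `c / 2 * ‖· - z‖ ^ 2` around `u`. -/
theorem half_mul_norm_sub_sq_expand (c : ℝ) (z u v : E) :
    c / 2 * ‖v - z‖ ^ 2 =
      c / 2 * ‖u - z‖ ^ 2 + ⟪c • (u - z), v - u⟫ + c / 2 * ‖v - u‖ ^ 2 := by
  rw [← sub_add_sub_cancel v u z, norm_add_sq_real, inner_smul_left, conj_trivial,
    real_inner_comm (u - z)]
  ring

/-- Proximal maps of functions with monotone gradient are nonexpansive. -/
theorem norm_sub_le_of_prox {g' : E → E} {c : ℝ} (hc : 0 < c) {x₁ x₂ z₁ z₂ : E}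
    (hmono : 0 ≤ ⟪g' x₁ - g' x₂, x₁ - x₂⟫)
    (h₁ : g' x₁ + c • (x₁ - z₁) = 0) (h₂ : g' x₂ + c • (x₂ - z₂) = 0) :
    ‖x₁ - x₂‖ ≤ ‖z₁ - z₂‖ := by
  have hd : g' x₁ - g' x₂ = c • ((z₁ - z₂) - (x₁ - x₂)) := by
    rw [eq_neg_of_add_eq_zero_left h₁, eq_neg_of_add_eq_zero_left h₂]; module
  rw [hd, inner_smul_left, conj_trivial, inner_sub_left, real_inner_self_eq_norm_sq] at hmono
  have h := nonneg_of_mul_nonneg_right hmono hc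
  have hcs := real_inner_le_norm (z₁ - z₂) (x₁ - x₂)
  by_contra! hlt
  nlinarith [norm_nonneg (z₁ - z₂)]

end FirstOrder

/-- The skew-symmetric coupling `(p, r) ↦ (p - αAr, r + αAᵀp)` does not decrease norms. -/
theorem norm_sq_le_skew_coupling {E F : Type*} [NormedAddCommGroup E] [InnerProductSpace ℝ E]
    [CompleteSpace E] [NormedAddCommGroup F] [InnerProductSpace ℝ F] [CompleteSpace F]
    (A : F →L[ℝ] E) (α : ℝ) (p : E) (r : F) :
    ‖p‖ ^ 2 ≤ ‖p - α • A r‖ ^ 2 + ‖r + α • (ContinuousLinearMap.adjoint A) p‖ ^ 2 := by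
  rw [norm_sub_sq_real, norm_add_sq_real, inner_smul_right, inner_smul_right,
    ContinuousLinearMap.adjoint_inner_right, real_inner_comm p (A r)]
  nlinarith [sq_nonneg ‖α • A r‖, sq_nonneg ‖r‖,
    sq_nonneg ‖α • (ContinuousLinearMap.adjoint A) p‖]

set_option maxHeartbeats 400000 in
/-- inner AGD complexity in DIPPA.
In the DIPPA setting, fix `k ≥ 1` with `‖z_k − z*‖² + ‖w_k − w*‖² ≤ C·C₀·(1 − ρ)^k`.
Then `G_k(x) = g(x) + (1/(2α))‖x − z_k‖²` is `(L + √(Lμ))`-smooth and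
`(μ + √(Lμ))`-strongly convex with condition number
`(L + √(Lμ))/(μ + √(Lμ)) = √κ`, and the AGD iterates started from `x_{k−1}` reach an
`ε_k`-minimizer of `G_k` after `K₁ = ⌊κ^{1/4} log(32C(√L + √μ)²/(μ(1 − ρ)))⌋ + 1` steps. -/
theorem stmt_12 {dx dy : ℕ}
    (g : EuclideanSpace ℝ (Fin dx) → ℝ) (h : EuclideanSpace ℝ (Fin dy) → ℝ)
    (g' : EuclideanSpace ℝ (Fin dx) → EuclideanSpace ℝ (Fin dx))
    (h' : EuclideanSpace ℝ (Fin dy) → EuclideanSpace ℝ (Fin dy))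
    (L μ : ℝ) (hμ : 0 < μ) (hμL : μ ≤ L)
    (hgdiff : ∀ u, HasGradientAt g (g' u) u) (hhdiff : ∀ v, HasGradientAt h (h' v) v)
    (hgsmooth : ∀ u₁ u₂, ‖g' u₁ - g' u₂‖ ≤ L * ‖u₁ - u₂‖)
    (hhsmooth : ∀ v₁ v₂, ‖h' v₁ - h' v₂‖ ≤ L * ‖v₁ - v₂‖)
    (hgsc : ∀ u₁ u₂, g u₂ ≥ g u₁ + ⟪g' u₁, u₂ - u₁⟫ + μ / 2 * ‖u₂ - u₁‖ ^ 2)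
    (hhsc : ∀ v₁ v₂, h v₂ ≥ h v₁ + ⟪h' v₁, v₂ - v₁⟫ + μ / 2 * ‖v₂ - v₁‖ ^ 2)
    (A : EuclideanSpace ℝ (Fin dy) →L[ℝ] EuclideanSpace ℝ (Fin dx))
    (xs : EuclideanSpace ℝ (Fin dx)) (ys : EuclideanSpace ℝ (Fin dy))
    (hsaddle : ∀ (x : EuclideanSpace ℝ (Fin dx)) (y : EuclideanSpace ℝ (Fin dy)),
      g xs + ⟪xs, A y⟫ - h y ≤ g xs + ⟪xs, A ys⟫ - h ys ∧
      g xs + ⟪xs, A ys⟫ - h ys ≤ g x + ⟪x, A ys⟫ - h ys)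
    (α κ ρ C₀ C : ℝ) (x₀ : EuclideanSpace ℝ (Fin dx)) (y₀ : EuclideanSpace ℝ (Fin dy))
    (hα : α = 1 / Real.sqrt (L * μ)) (hκ : κ = L / μ)
    (hρ : ρ = 1 / (2 * Real.sqrt κ))
    (hC₀ : C₀ = ‖x₀ - xs‖ ^ 2 + ‖y₀ - ys‖ ^ 2)
    (hC : C = 4 * Real.sqrt κ + 1 + ‖A‖ ^ 2 / (L * μ))
    (k : ℕ) (hk : 1 ≤ k) (εk : ℝ) (hεk : εk = C₀ * μ / 16 * (1 - ρ) ^ (k + 1))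
    -- the current iterate `(x_{k−1}, y_{k−1})` and the associated `z_k`, `w_k`
    (xkm1 : EuclideanSpace ℝ (Fin dx)) (ykm1 : EuclideanSpace ℝ (Fin dy))
    (zk : EuclideanSpace ℝ (Fin dx)) (wk : EuclideanSpace ℝ (Fin dy))
    (hzk : zk = xkm1 - α • A ykm1)
    (hwk : wk = ykm1 + α • (ContinuousLinearMap.adjoint A) xkm1)
    (hbound :
      ‖zk - (xs - α • A ys)‖ ^ 2 +
        ‖wk - (ys + α • (ContinuousLinearMap.adjoint A) xs)‖ ^ 2 ≤ C * C₀ * (1 - ρ) ^ k)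
    -- AGD applied to `G_k` (smoothness `L + √(Lμ)`, strong convexity `μ + √(Lμ)`)
    (K₁ : ℕ)
    (hK₁ : K₁ = ⌊κ ^ ((1 : ℝ) / 4) *
      Real.log (32 * C * (Real.sqrt L + Real.sqrt μ) ^ 2 / (μ * (1 - ρ)))⌋₊ + 1)
    (a at' : ℕ → EuclideanSpace ℝ (Fin dx))
    (ha0 : a 0 = xkm1) (hat0 : at' 0 = a 0)
    (hstep : ∀ t : ℕ, a (t + 1) =
      at' t - (1 / (L + Real.sqrt (L * μ))) • (g' (at' t) + (1 / α) • (at' t - zk)))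
    (hmom : ∀ t : ℕ, at' (t + 1) = a (t + 1) +
      ((Real.sqrt ((L + Real.sqrt (L * μ)) / (μ + Real.sqrt (L * μ))) - 1) /
        (Real.sqrt ((L + Real.sqrt (L * μ)) / (μ + Real.sqrt (L * μ))) + 1)) •
          (a (t + 1) - a t)) :
    (∀ u₁ u₂ : EuclideanSpace ℝ (Fin dx),
        ‖(g' u₁ + (1 / α) • (u₁ - zk)) - (g' u₂ + (1 / α) • (u₂ - zk))‖ ≤
          (L + Real.sqrt (L * μ)) * ‖u₁ - u₂‖) ∧
    (∀ u₁ u₂ : EuclideanSpace ℝ (Fin dx),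
        g u₂ + 1 / (2 * α) * ‖u₂ - zk‖ ^ 2 ≥
          g u₁ + 1 / (2 * α) * ‖u₁ - zk‖ ^ 2 +
            ⟪g' u₁ + (1 / α) • (u₁ - zk), u₂ - u₁⟫ +
            (μ + Real.sqrt (L * μ)) / 2 * ‖u₂ - u₁‖ ^ 2) ∧
    (L + Real.sqrt (L * μ)) / (μ + Real.sqrt (L * μ)) = Real.sqrt κ ∧
    (∀ u : EuclideanSpace ℝ (Fin dx),
        g (a K₁) + 1 / (2 * α) * ‖a K₁ - zk‖ ^ 2 ≤
          g u + 1 / (2 * α) * ‖u - zk‖ ^ 2 + εk) := by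
  set c := Real.sqrt (L * μ) with hc
  have hL : 0 < L := hμ.trans_le hμL
  have hcpos : 0 < c := Real.sqrt_pos.2 (mul_pos hL hμ)
  have hαc : 1 / α = c := by rw [hα, one_div_one_div]
  have hα2c : 1 / (2 * α) = c / 2 := by rw [← hαc]; field_simp
  have hαpos : 0 < α := by rw [hα]; positivity
  have hκ1 : 1 ≤ κ := by rw [hκ, le_div_iff₀ hμ]; linarith
  have hsL : Real.sqrt L ^ 2 = L := Real.sq_sqrt hL.le
  have hsμ : Real.sqrt μ ^ 2 = μ := Real.sq_sqrt hμ.le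
  have hcmul : c = Real.sqrt L * Real.sqrt μ := Real.sqrt_mul hL.le μ
  have hsLpos : 0 < Real.sqrt L := Real.sqrt_pos.2 hL
  have hsμpos : 0 < Real.sqrt μ := Real.sqrt_pos.2 hμ
  have hratio : (L + c) / (μ + c) = Real.sqrt κ := by
    rw [hκ, Real.sqrt_div hL.le, div_eq_div_iff (by positivity) (by positivity), hcmul]
    linear_combination -Real.sqrt μ * hsL + Real.sqrt L * hsμ
  rw [hαc] at hstep ⊢
  rw [hα2c]
  rw [hratio] at hmom
  set q := Real.sqrt (Real.sqrt κ) with hq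
  have hq1 : 1 ≤ q := Real.one_le_sqrt.2 (Real.one_le_sqrt.2 hκ1)
  have hq0 : 0 < q := by linarith
  have hq2 : q ^ 2 = Real.sqrt κ := Real.sq_sqrt (Real.sqrt_nonneg κ)
  have hqpow : κ ^ ((1 : ℝ) / 4) = q := by
    rw [hq, Real.sqrt_eq_rpow, Real.sqrt_eq_rpow, ← Real.rpow_mul (by linarith)]
    norm_num
  have hm : 0 < μ + c := by positivity
  have hℓ : (μ + c) * q ^ 2 = L + c := by
    rw [hq2, ← hratio]; field_simp
  have hρ0 : 0 < 1 - ρ := by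
    have hs1 : 1 ≤ Real.sqrt κ := Real.one_le_sqrt.2 hκ1
    have : ρ < 1 := by
      rw [hρ, div_lt_one (by positivity)]; linarith
    linarith
  have hgdesc := descent_of_lipschitz_gradient_s12 hgdiff hgsmooth
  have hsc : ∀ u₁ u₂ : EuclideanSpace ℝ (Fin dx),
      g u₁ + c / 2 * ‖u₁ - zk‖ ^ 2 + ⟪g' u₁ + c • (u₁ - zk), u₂ - u₁⟫ +
        (μ + c) / 2 * ‖u₂ - u₁‖ ^ 2 ≤ g u₂ + c / 2 * ‖u₂ - zk‖ ^ 2 := by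
    intro u₁ u₂
    rw [half_mul_norm_sub_sq_expand c zk u₁ u₂, inner_add_left]
    linarith [hgsc u₁ u₂]
  have hsm : ∀ u₁ u₂ : EuclideanSpace ℝ (Fin dx),
      g u₂ + c / 2 * ‖u₂ - zk‖ ^ 2 ≤ g u₁ + c / 2 * ‖u₁ - zk‖ ^ 2 +
        ⟪g' u₁ + c • (u₁ - zk), u₂ - u₁⟫ + (μ + c) * q ^ 2 / 2 * ‖u₂ - u₁‖ ^ 2 := by
    intro u₁ u₂
    rw [half_mul_norm_sub_sq_expand c zk u₁ u₂, inner_add_left, hℓ]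
    linarith [hgdesc u₁ u₂]
  refine ⟨fun u₁ u₂ => ?_, hsc, hratio, fun u => ?_⟩
  · have hsplit : (g' u₁ + c • (u₁ - zk)) - (g' u₂ + c • (u₂ - zk)) =
        (g' u₁ - g' u₂) + c • (u₁ - u₂) := by module
    rw [hsplit, add_mul]
    refine (norm_add_le _ _).trans (add_le_add (hgsmooth u₁ u₂) (le_of_eq ?_))
    rw [norm_smul, Real.norm_of_nonneg hcpos.le]
  have hgcont : Continuous g :=
    continuous_iff_continuousAt.2 fun u => (hgdiff u).hasFDerivAt.continuousAt
  obtain ⟨xm, hxm⟩ := exists_forall_le_of_strongly_convex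
    (φ := fun u => g u + c / 2 * ‖u - zk‖ ^ 2) (φ' := fun u => g' u + c • (u - zk)) hm
    (by fun_prop) hsc
  have hxm0 : g' xm + c • (xm - zk) = 0 :=
    gradient_eq_zero_of_forall_le (φ := fun u => g u + c / 2 * ‖u - zk‖ ^ 2)
      (φ' := fun u => g' u + c • (u - zk)) (by positivity) hsm hxm
  have hagd := agd_convergence (φ := fun u => g u + c / 2 * ‖u - zk‖ ^ 2)
    (φ' := fun u => g' u + c • (u - zk)) hm hq1 hsm hsc hat0
    (by simpa only [hℓ] using hstep) hmom hxm0 K₁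
  have hxs : g' xs + A ys = 0 := by
    refine gradient_eq_zero_of_forall_le (φ := fun u => g u + ⟪u, A ys⟫)
      (φ' := fun u => g' u + A ys) hL (fun u v => ?_) fun v => by linarith [(hsaddle v ys).2]
    have hd := hgdesc u v
    rw [inner_add_left, inner_sub_right (A ys), real_inner_comm v, real_inner_comm u]
    linarith
  have hxs0 : g' xs + c • (xs - (xs - α • A ys)) = 0 := by
    rw [sub_sub_cancel, smul_smul, ← hαc, one_div_mul_cancel hαpos.ne', one_smul, hxs]
  have hmono : 0 ≤ ⟪g' xm - g' xs, xm - xs⟫ := by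
    have h₁ := hgsc xm xs
    have h₂ := hgsc xs xm
    rw [← neg_sub xm xs, inner_neg_right, norm_neg] at h₁
    rw [inner_sub_left]
    linarith [mul_nonneg hμ.le (sq_nonneg ‖xm - xs‖)]
  have hprox := norm_sub_le_of_prox hcpos hmono hxm0 hxs0
  have hskew := norm_sq_le_skew_coupling A α (xkm1 - xs) (ykm1 - ys)
  have hz : xkm1 - xs - α • A (ykm1 - ys) = zk - (xs - α • A ys) := by
    rw [hzk, map_sub]; module
  have hw : ykm1 - ys + α • (ContinuousLinearMap.adjoint A) (xkm1 - xs) =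
      wk - (ys + α • (ContinuousLinearMap.adjoint A) xs) := by
    rw [hwk, map_sub]; module
  rw [hz, hw] at hskew
  have hdist : ‖a 0 - xm‖ ^ 2 ≤ 4 * (C * C₀ * (1 - ρ) ^ k) := by
    have htri : ‖a 0 - xm‖ ≤ ‖xkm1 - xs‖ + ‖xm - xs‖ := by
      rw [ha0, ← sub_sub_sub_cancel_right xkm1 xm xs]
      exact norm_sub_le _ _
    have hsq := pow_le_pow_left₀ (norm_nonneg _) htri 2
    have hpsq := pow_le_pow_left₀ (norm_nonneg _) hprox 2
    linarith [sq_nonneg (‖xkm1 - xs‖ - ‖xm - xs‖),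
      sq_nonneg ‖wk - (ys + α • (ContinuousLinearMap.adjoint A) xs)‖]
  have hCpos : 0 < C := by rw [hC]; positivity
  set S := Real.sqrt L + Real.sqrt μ with hS
  have hSpos : 0 < S := by positivity
  have hS2 : (μ + c) * q ^ 2 + (μ + c) = S ^ 2 := by
    rw [hℓ, hcmul, hS]
    linear_combination -hsL - hsμ
  have hB : 0 < 32 * C * S ^ 2 / (μ * (1 - ρ)) := by positivity
  have hexp : Real.exp (-(K₁ / q)) ≤ μ * (1 - ρ) / (32 * C * S ^ 2) := by
    have hK : q * Real.log (32 * C * S ^ 2 / (μ * (1 - ρ))) ≤ K₁ := by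
      rw [hK₁, hqpow]
      push_cast
      exact (Nat.lt_floor_add_one _).le
    rw [← inv_div (32 * C * S ^ 2), ← Real.exp_log hB, ← Real.exp_neg]
    refine Real.exp_le_exp.2 (neg_le_neg ?_)
    rw [le_div_iff₀ hq0]
    linarith
  rw [hS2] at hagd
  have hfinal : S ^ 2 / 2 * ‖a 0 - xm‖ ^ 2 * Real.exp (-(K₁ / q)) ≤ εk := by
    calc S ^ 2 / 2 * ‖a 0 - xm‖ ^ 2 * Real.exp (-(K₁ / q))
        ≤ S ^ 2 / 2 * (4 * (C * C₀ * (1 - ρ) ^ k)) * (μ * (1 - ρ) / (32 * C * S ^ 2)) := by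
          gcongr
          exact mul_nonneg (by positivity) ((sq_nonneg _).trans hdist)
      _ = εk := by
          rw [hεk, pow_succ]
          field_simp
          ring
  have hu : g xm + c / 2 * ‖xm - zk‖ ^ 2 ≤ g u + c / 2 * ‖u - zk‖ ^ 2 := hxm u
  linarith
end

section
/- (Inner APFB complexity in DIPPA.) In the setting of the DIPPA outer-loop theorem (g, h differentiable, L-smooth, μ-strongly convex, 0 < μ ≤ L, α = 1/√(Lμ), κ = L/μ, ρ = 1/(2√κ), C₀ = ‖x₀ − x*‖² + ‖y₀ − y*‖², ε_k = (C₀μ/16)(1 − ρ)^{k+1}, δ_k = C₀Lμ(1 − ρ)^{k+1}/(2(1 + √κ)(Lμ + ‖A‖²)), C = 4√κ + 1 + ‖A‖²/(Lμ)), fix k ≥ 1, assume ‖z_k − z*‖² + ‖w_k − w*‖² ≤ C·C₀·(1 − ρ)^k, that x̃_k is an ε_k-minimizer of G_k(x) = g(x) + (1/(2α))‖x − z_k‖² and ỹ_k is an ε_k-minimizer of H_k(y) = h(y) + (1/(2α))‖y − w_k‖², and let (x_k*, y_k*) be the saddle point of the quadratic subproblem f̃_k(x,y) = (1/(2α))‖x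 − 2x̃_k + z_k‖² + ⟨x, Ay⟩ − (1/(2α))‖y − 2ỹ_k + w_k‖². Then ‖x_{k−1} − x_k*‖² + ‖y_{k−1} − y_k*‖² ≤ C₀(4C(1 − ρ)^k + (1 − ρ)^{k+1}), and running the APFB algorithm on f̃_k from initial point (x_{k−1}, y_{k−1}) for K₂ = ⌊(‖A‖/√(Lμ) + 1)·log(20C(1 + √κ)(Lμ + ‖A‖²)/(Lμ(1 − ρ)))⌋ + 2 iterations produces (x_k, y_k) with ‖x_k − x_k*‖² + ‖y_k − y_k*‖² ≤ δ_k. -/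
open scoped RealInnerProductSpace

section
variable {E F : Type*} [NormedAddCommGroup E] [InnerProductSpace ℝ E]
  [NormedAddCommGroup F] [InnerProductSpace ℝ F]

theorem eq_of_forall_sum_sq_le {m n : ℝ} (hm : 0 < m) (hn : 0 ≤ n) {p c x : E}
    (hx : ∀ u, m / 2 * ‖x - p‖ ^ 2 + n / 2 * ‖x - c‖ ^ 2 ≤
      m / 2 * ‖u - p‖ ^ 2 + n / 2 * ‖u - c‖ ^ 2) :
    (m + n) • x = m • p + n • c := by
  have hmn : 0 < m + n := by linarith
  set v := (m + n)⁻¹ • (m • p + n • c) with hv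
  have hv' : (m + n) • v = m • p + n • c := by
    rw [hv, smul_smul, mul_inv_cancel₀ hmn.ne', one_smul]
  have hsq : ∀ q : E, ‖x - q‖ ^ 2 = ‖x - v‖ ^ 2 + 2 * ⟪x - v, v - q⟫ + ‖v - q‖ ^ 2 := by
    intro q
    rw [← norm_add_sq_real, sub_add_sub_cancel]
  have h0 : m * ⟪x - v, v - p⟫ + n * ⟪x - v, v - c⟫ = 0 := by
    rw [← real_inner_smul_right, ← real_inner_smul_right, ← inner_add_right]
    have : m • (v - p) + n • (v - c) = 0 := by
      have : m • (v - p) + n • (v - c) = (m + n) • v - (m • p + n • c) := by module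
      rw [this, hv', sub_self]
    rw [this, inner_zero_right]
  have h1 := hx v
  rw [hsq p, hsq c] at h1
  have h2 : (m + n) * ‖x - v‖ ^ 2 ≤ 0 := by nlinarith
  have h3 : ‖x - v‖ ^ 2 ≤ 0 := by
    by_contra! h
    nlinarith [mul_pos hmn h]
  have h4 : x - v = 0 := by
    rw [← norm_eq_zero]; exact pow_eq_zero_iff (two_ne_zero) |>.1 (le_antisymm h3 (sq_nonneg _))
  rw [sub_eq_zero.1 h4, hv']

variable [CompleteSpace E] [CompleteSpace F]

theorem le_add_inner_add_sq_of_lipschitz_gradient_s13 {g : E → ℝ} {g' : E → E} {L : ℝ}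
    (hg : ∀ u, HasGradientAt g (g' u) u) (hL : ∀ u v, ‖g' u - g' v‖ ≤ L * ‖u - v‖) (u v : E) :
    g v ≤ g u + ⟪g' u, v - u⟫ + L / 2 * ‖v - u‖ ^ 2 := by
  set d := v - u with hd
  have hline : ∀ t : ℝ, HasDerivAt (fun t : ℝ => u + t • d) d t := fun t => by
    simpa using ((hasDerivAt_id t).smul_const d).const_add u
  have hder : ∀ t : ℝ, HasDerivAt
      (fun t : ℝ => g (u + t • d) - t * ⟪g' u, d⟫ - L / 2 * ‖d‖ ^ 2 * t ^ 2)
      (⟪g' (u + t • d), d⟫ - ⟪g' u, d⟫ - L * ‖d‖ ^ 2 * t) t := fun t => by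
    have h1 : HasDerivAt (fun t : ℝ => g (u + t • d)) ⟪g' (u + t • d), d⟫ t := by
      have h := (hg (u + t • d)).hasFDerivAt.comp_hasDerivAt t (hline t)
      rwa [InnerProductSpace.toDual_apply_apply] at h
    have h2 := (h1.sub ((hasDerivAt_id t).mul_const ⟪g' u, d⟫)).sub
      (((hasDerivAt_id t).pow 2).const_mul (L / 2 * ‖d‖ ^ 2))
    refine h2.congr_deriv ?_
    simp only [id, Nat.cast_ofNat]
    ring
  have hanti : AntitoneOn
      (fun t : ℝ => g (u + t • d) - t * ⟪g' u, d⟫ - L / 2 * ‖d‖ ^ 2 * t ^ 2) (Set.Ici 0) := by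
    apply antitoneOn_of_deriv_nonpos (convex_Ici 0)
    · exact fun t _ => (hder t).continuousAt.continuousWithinAt
    · exact fun t _ => (hder t).differentiableAt.differentiableWithinAt
    · intro t ht
      rw [interior_Ici, Set.mem_Ioi] at ht
      rw [(hder t).deriv, ← inner_sub_left]
      have h1 := real_inner_le_norm (g' (u + t • d) - g' u) d
      have h2 := hL (u + t • d) u
      rw [add_sub_cancel_left, norm_smul, Real.norm_of_nonneg ht.le] at h2
      nlinarith [mul_le_mul_of_nonneg_right h2 (norm_nonneg d)]
  have h := hanti (Set.mem_Ici.2 le_rfl) (Set.mem_Ici.2 zero_le_one) zero_le_one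
  simp only [one_smul, zero_smul, add_zero, hd, add_sub_cancel] at h
  rw [← hd] at h
  linarith

/-- The interpolation inequality for gradients of smooth strongly convex functions. -/
theorem sq_add_sq_le_inner_gradient_sub {g : E → ℝ} {g' : E → E} {L μ : ℝ} (hμL : μ ≤ L)
    (hg : ∀ u, HasGradientAt g (g' u) u) (hL : ∀ u v, ‖g' u - g' v‖ ≤ L * ‖u - v‖)
    (hsc : ∀ u v, g v ≥ g u + ⟪g' u, v - u⟫ + μ / 2 * ‖v - u‖ ^ 2) (x y : E) :
    ‖g' x - g' y‖ ^ 2 + L * μ * ‖x - y‖ ^ 2 ≤ (L + μ) * ⟪g' x - g' y, x - y⟫ := by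
  set d := g' x - g' y - μ • (x - y) with hd
  have key : ∀ t : ℝ, (2 * t - (L - μ) * t ^ 2) * ‖d‖ ^ 2 ≤ ⟪d, x - y⟫ := by
    have half : ∀ (t : ℝ) (x y : E) (d : E), d = g' x - g' y - μ • (x - y) →
        (t - (L - μ) / 2 * t ^ 2) * ‖d‖ ^ 2 ≤
          g x - g y - ⟪g' y, x - y⟫ - μ / 2 * ‖x - y‖ ^ 2 := by
      intro t x y d hd
      have h1 := le_add_inner_add_sq_of_lipschitz_gradient_s13 hg hL x (x - t • d)
      have h2 := hsc y (x - t • d)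
      have e1 : x - t • d - x = -(t • d) := by abel
      have e2 : x - t • d - y = (x - y) - t • d := by abel
      have e3 : g' x = d + g' y + μ • (x - y) := by rw [hd]; abel
      rw [e1, norm_neg, norm_smul, e3] at h1
      rw [e2, norm_sub_sq_real, norm_smul] at h2
      simp only [inner_neg_right, inner_sub_right, inner_add_left, real_inner_smul_left,
        real_inner_smul_right, mul_pow, Real.norm_eq_abs, sq_abs,
        real_inner_self_eq_norm_sq] at h1 h2 ⊢
      rw [inner_sub_left] at h2
      rw [inner_sub_left] at h1
      linarith
    intro t
    have h1 := half t x y d hd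
    have h2 := half t y x (-d) (by rw [hd, ← neg_sub x y]; module)
    rw [norm_neg, ← neg_sub x y, norm_neg, inner_neg_right] at h2
    have h3 : ⟪d, x - y⟫ = ⟪g' x, x - y⟫ - ⟪g' y, x - y⟫ - μ * ‖x - y‖ ^ 2 := by
      rw [hd, inner_sub_left, inner_sub_left, real_inner_smul_left, real_inner_self_eq_norm_sq]
    linarith
  have hco : ‖d‖ ^ 2 ≤ (L - μ) * ⟪d, x - y⟫ := by
    rcases hμL.eq_or_lt with h | h
    · have h0 : ‖d‖ ^ 2 = 0 := by
        by_contra hne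
        have h1 := key ((⟪d, x - y⟫ + 1) / (2 * ‖d‖ ^ 2))
        rw [h, sub_self, zero_mul, sub_zero, mul_div_assoc', mul_div_mul_left _ _ two_ne_zero,
          div_mul_cancel₀ _ hne] at h1
        linarith
      rw [h0, h]; simp
    · have hpos : 0 < L - μ := by linarith
      have h1 := key (1 / (L - μ))
      have h2 : 2 * (1 / (L - μ)) - (L - μ) * (1 / (L - μ)) ^ 2 = 1 / (L - μ) := by
        field_simp; ring
      rw [h2, one_div, inv_mul_le_iff₀ hpos] at h1
      exact h1
  have e1 : ‖d‖ ^ 2 = ‖g' x - g' y‖ ^ 2 - 2 * μ * ⟪g' x - g' y, x - y⟫ + μ ^ 2 * ‖x - y‖ ^ 2 := by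
    rw [hd, norm_sub_sq_real, norm_smul, real_inner_smul_right, mul_pow, Real.norm_eq_abs, sq_abs]
    ring
  have e2 : ⟪d, x - y⟫ = ⟪g' x - g' y, x - y⟫ - μ * ‖x - y‖ ^ 2 := by
    rw [hd, inner_sub_left, real_inner_smul_left, real_inner_self_eq_norm_sq]
  rw [e1, e2] at hco
  linarith

theorem gradient_eq_of_forall_le {f : E → ℝ} {f' x : E} (hf : HasGradientAt f f' x)
    (hx : ∀ u, f x ≤ f u) : f' = 0 := by
  have h := (IsLocalMin.hasFDerivAt_eq_zero (f := f) (Filter.Eventually.of_forall hx)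
    hf.hasFDerivAt)
  simpa using h

theorem hasGradientAt_half_sq (m : ℝ) (z x : E) :
    HasGradientAt (fun u => m / 2 * ‖u - z‖ ^ 2) (m • (x - z)) x := by
  rw [hasGradientAt_iff_hasFDerivAt]
  have h := (((hasFDerivAt_id x).sub_const z).norm_sq).const_mul (m / 2)
  refine h.congr_fderiv ?_
  ext v
  simp
  ring

theorem HasGradientAt.add' {f g : E → ℝ} {f' g' x : E} (hf : HasGradientAt f f' x)
    (hg : HasGradientAt g g' x) : HasGradientAt (fun u => f u + g u) (f' + g') x := by
  rw [hasGradientAt_iff_hasFDerivAt] at *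
  rw [map_add]
  exact hf.add hg

theorem hasGradientAt_inner (c x : E) : HasGradientAt (fun u => ⟪c, u⟫) c x := by
  rw [hasGradientAt_iff_hasFDerivAt]
  exact ((InnerProductSpace.toDual ℝ E) c).hasFDerivAt

theorem exists_prox [ProperSpace E] {g : E → ℝ} {g' : E → E} {m μ : ℝ} (hm : 0 < m) (hμ : 0 < μ)
    (hg : ∀ u, HasGradientAt g (g' u) u)
    (hsc : ∀ u v, g v ≥ g u + ⟪g' u, v - u⟫ + μ / 2 * ‖v - u‖ ^ 2) (z : E) :
    ∃ x, g' x + m • (x - z) = 0 := by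
  have hG : ∀ x, HasGradientAt (fun u => g u + m / 2 * ‖u - z‖ ^ 2) (g' x + m • (x - z)) x :=
    fun x => (hg x).add' (hasGradientAt_half_sq m z x)
  have hcont : Continuous (fun u => g u + m / 2 * ‖u - z‖ ^ 2) :=
    continuous_iff_continuousAt.2 fun x => (hG x).continuousAt
  have htend : Filter.Tendsto (fun u => g u + m / 2 * ‖u - z‖ ^ 2) (Filter.cocompact E)
      Filter.atTop := by
    have h1 : Filter.Tendsto (fun r : ℝ => g 0 + r * (μ / 2 * r - ‖g' 0‖)) Filter.atTop
        Filter.atTop := by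
      apply Filter.tendsto_atTop_add_const_left
      apply Filter.tendsto_id.atTop_mul_atTop₀
      exact Filter.tendsto_atTop_add_const_right _ _
        (Filter.tendsto_id.const_mul_atTop (by positivity))
    refine Filter.tendsto_atTop_mono ?_ (h1.comp (tendsto_norm_cocompact_atTop (E := E)))
    intro u
    have h2 := hsc 0 u
    have h3 := neg_le_of_abs_le (abs_real_inner_le_norm (g' 0) u)
    have h4 : 0 ≤ m / 2 * ‖u - z‖ ^ 2 := by positivity
    simp only [sub_zero] at h2
    simp only [Function.comp]
    nlinarith
  obtain ⟨x, hx⟩ := hcont.exists_forall_le htend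
  exact ⟨x, gradient_eq_of_forall_le (hG x) hx⟩

/-- The reflected proximal step is nonexpansive, up to the inexactness of the proximal step. -/
theorem norm_reflected_prox_sub_sq_le [ProperSpace E] {g : E → ℝ} {g' : E → E} {L μ m s ε : ℝ}
    (hμ : 0 < μ) (hs : 1 ≤ s) (hLs : L = μ * s ^ 2) (hms : m = μ * s)
    (hg : ∀ u, HasGradientAt g (g' u) u) (hL : ∀ u v, ‖g' u - g' v‖ ≤ L * ‖u - v‖)
    (hsc : ∀ u v, g v ≥ g u + ⟪g' u, v - u⟫ + μ / 2 * ‖v - u‖ ^ 2)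
    {z zs xs xt : E} (hxs : g' xs = m • (zs - xs))
    (hxt : ∀ u, g xt + m / 2 * ‖xt - z‖ ^ 2 ≤ g u + m / 2 * ‖u - z‖ ^ 2 + ε) :
    ‖((2 : ℝ) • xt - z) - ((2 : ℝ) • xs - zs)‖ ^ 2 ≤ ‖z - zs‖ ^ 2 + 4 * ε / μ := by
  have hs0 : 0 < s := by linarith
  have hm : 0 < m := by rw [hms]; positivity
  have hμL : μ ≤ L := by rw [hLs]; nlinarith
  obtain ⟨x, hx⟩ := exists_prox hm hμ hg hsc z
  have hx' : g' x = m • (z - x) := by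
    rw [eq_neg_of_add_eq_zero_left hx]; module
  have hε : μ * (s + 1) / 2 * ‖xt - x‖ ^ 2 ≤ ε := by
    have h1 := hxt x
    have h2 := hsc x xt
    have h3 : ‖xt - z‖ ^ 2 = ‖xt - x‖ ^ 2 - 2 * ⟪z - x, xt - x⟫ + ‖x - z‖ ^ 2 := by
      rw [← sub_add_sub_cancel xt x z, norm_add_sq_real, ← neg_sub z x, inner_neg_right,
        real_inner_comm, norm_neg]
      ring
    rw [hx', real_inner_smul_left] at h2
    rw [h3] at h1
    rw [hms] at h1 h2
    linarith
  set w := z - zs with hw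
  set d := x - xs with hd
  set e := xt - x with he
  have hR : (s + 1) ^ 2 * ‖(2 : ℝ) • d - w‖ ^ 2 ≤ (s - 1) ^ 2 * ‖w‖ ^ 2 := by
    have h1 := sq_add_sq_le_inner_gradient_sub hμL hg hL hsc x xs
    have h2 : g' x - g' xs = m • (w - d) := by rw [hx', hxs, hw, hd]; module
    rw [h2, norm_smul, real_inner_smul_left, ← hd, mul_pow, Real.norm_eq_abs, sq_abs,
      norm_sub_sq_real, inner_sub_left w d d, real_inner_self_eq_norm_sq] at h1
    rw [norm_sub_sq_real, norm_smul, real_inner_smul_left, real_inner_comm, mul_pow]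
    norm_num
    rw [hLs, hms] at h1
    have h3 : (μ ^ 2 * s) * (s * (‖w‖ ^ 2 - 2 * (⟪w, d⟫ - ‖d‖ ^ 2))) ≤
        (μ ^ 2 * s) * ((s ^ 2 + 1) * (⟪w, d⟫ - ‖d‖ ^ 2)) := by linarith
    have h4 := le_of_mul_le_mul_left h3 (by positivity)
    linarith
  have hsplit : ((2 : ℝ) • xt - z) - ((2 : ℝ) • xs - zs) = ((2 : ℝ) • d - w) + (2 : ℝ) • e := by
    rw [hw, hd, he]; module
  rw [hsplit]
  set R := (2 : ℝ) • d - w with hRdef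
  have hE : 2 * (s + 1) * ‖e‖ ^ 2 ≤ 4 * ε / μ := by
    rw [le_div_iff₀ hμ]; linarith
  refine le_trans ?_ (add_le_add_right hE _)
  rcases hs.eq_or_lt with h | h
  · rw [← h] at hR ⊢
    have hR0 : ‖R‖ ^ 2 ≤ 0 := by linarith
    have hR1 : R = 0 := by
      rw [← norm_eq_zero]
      exact (pow_eq_zero_iff two_ne_zero).1 (le_antisymm hR0 (sq_nonneg _))
    rw [hR1, zero_add, norm_smul, mul_pow]
    norm_num
  · have h1 : ‖R + (2 : ℝ) • e‖ ^ 2 = ‖R‖ ^ 2 + 4 * ⟪R, e⟫ + 4 * ‖e‖ ^ 2 := by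
      rw [norm_add_sq_real, real_inner_smul_right, norm_smul, mul_pow]
      norm_num
      ring
    have h2 : 0 ≤ ‖R‖ ^ 2 - 2 * (s - 1) * ⟪R, e⟫ + (s - 1) ^ 2 * ‖e‖ ^ 2 := by
      have := sq_nonneg ‖R - (s - 1) • e‖
      rw [norm_sub_sq_real, real_inner_smul_right, norm_smul, mul_pow, Real.norm_eq_abs,
        sq_abs] at this
      linarith
    have hs1 : 0 < s - 1 := by linarith
    have h3 : (s + 1) * ‖R‖ ^ 2 ≤ (s - 1) * ‖w‖ ^ 2 := by
      have h4 : (s + 1) ^ 2 * ‖R‖ ^ 2 ≤ (s + 1) * ((s - 1) * ‖w‖ ^ 2) := by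
        nlinarith [mul_nonneg hs1.le (sq_nonneg ‖w‖)]
      refine le_of_mul_le_mul_left (a := s + 1) ?_ (by linarith)
      linarith
    refine le_of_mul_le_mul_left (a := s - 1) ?_ hs1
    rw [h1]
    nlinarith

theorem norm_sq_add_norm_sq_le_of_alternating_step {S : F →L[ℝ] E} (hS : ‖S‖ ≤ 1) {θ : ℝ}
    (hθ0 : 0 ≤ θ) (hθ1 : θ ≤ 1) {a a₁ : E} {b b₁ : F}
    (hb : b₁ = b + θ • (ContinuousLinearMap.adjoint S) (a - S b)) (ha : a₁ = a - θ • S b₁) :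
    ‖a₁‖ ^ 2 + ‖b₁‖ ^ 2 ≤ ‖a‖ ^ 2 + ‖b‖ ^ 2 := by
  set e := a - S b with he
  set p := S b with hp
  set r := (ContinuousLinearMap.adjoint S) e with hr
  set q := S r with hq
  have hqr : ‖q‖ ^ 2 ≤ ‖r‖ ^ 2 := by
    have := S.le_of_opNorm_le hS r
    rw [one_mul] at this
    gcongr
  have hrr : ⟪e, q⟫ = ‖r‖ ^ 2 := by
    rw [hq, ← ContinuousLinearMap.adjoint_inner_left, ← hr, real_inner_self_eq_norm_sq]
  have hbr : ⟪b, r⟫ = ⟪p, e⟫ := by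
    rw [hr, ContinuousLinearMap.adjoint_inner_right]
  have ha' : a = e + p := by rw [he]; abel
  have ha₁ : a₁ = e + (1 - θ) • p - θ ^ 2 • q := by
    rw [ha, hb, map_add, map_smul, ← hp, ← hq, ha']
    module
  have e1 : ‖b₁‖ ^ 2 = ‖b‖ ^ 2 + 2 * θ * ⟪p, e⟫ + θ ^ 2 * ‖r‖ ^ 2 := by
    rw [hb, norm_add_sq_real, real_inner_smul_right, norm_smul, mul_pow, Real.norm_eq_abs, sq_abs,
      hbr]
    ring
  have e2 : ‖a₁‖ ^ 2 = ‖e‖ ^ 2 + (1 - θ) ^ 2 * ‖p‖ ^ 2 + θ ^ 4 * ‖q‖ ^ 2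
      + 2 * (1 - θ) * ⟪p, e⟫ - 2 * θ ^ 2 * ‖r‖ ^ 2 - 2 * (1 - θ) * θ ^ 2 * ⟪p, q⟫ := by
    rw [ha₁, norm_sub_sq_real, norm_add_sq_real, inner_add_left]
    simp only [real_inner_smul_left, real_inner_smul_right, norm_smul, mul_pow, Real.norm_eq_abs,
      sq_abs, hrr, real_inner_comm p e]
    ring
  have e3 : ‖a‖ ^ 2 = ‖e‖ ^ 2 + 2 * ⟪p, e⟫ + ‖p‖ ^ 2 := by
    rw [ha', norm_add_sq_real, real_inner_comm]
  have h1 : 0 ≤ ‖p‖ ^ 2 + 2 * ⟪p, q⟫ + ‖q‖ ^ 2 := by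
    rw [← norm_add_sq_real]; positivity
  have h2 : 0 ≤ (1 - θ) * θ ^ 2 := mul_nonneg (by linarith) (sq_nonneg _)
  have h3 : (1 - θ) * θ ^ 2 ≤ θ * (2 - θ) := by nlinarith [mul_nonneg hθ0 (sq_nonneg θ)]
  have h4 : (1 - θ) * θ ^ 2 ≤ θ ^ 2 * (1 - θ ^ 2) := by
    nlinarith [mul_nonneg h2 hθ0]
  have h5 := mul_nonneg h2 h1
  have h6 := mul_le_mul_of_nonneg_right h3 (sq_nonneg ‖p‖)
  have h7 := mul_le_mul_of_nonneg_right h4 (sq_nonneg ‖q‖)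
  have h8 := mul_le_mul_of_nonneg_left hqr (sq_nonneg θ)
  rw [e1, e2, e3]
  linarith

/-- Linear convergence of the extrapolated primal-dual iteration, in error coordinates. -/
theorem norm_sq_add_norm_sq_le_of_extrapolated_iteration {S : F →L[ℝ] E} (hS : ‖S‖ ≤ 1) {θ : ℝ}
    (hθ0 : 0 ≤ θ) (hθ1 : θ ≤ 1) {u w : ℕ → E} {v : ℕ → F} (hw0 : w 0 = u 0)
    (hw : ∀ t, w (t + 1) = u (t + 1) + θ • (u (t + 1) - u t))
    (hv : ∀ t, v (t + 1) = θ • (v t + (ContinuousLinearMap.adjoint S) (w t)))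
    (hu : ∀ t, u (t + 1) = θ • (u t - S (v (t + 1)))) (t : ℕ) :
    ‖u (t + 1)‖ ^ 2 + ‖v (t + 1)‖ ^ 2 ≤
      8 * (θ ^ 2) ^ (t + 1) * (‖u 0‖ ^ 2 + ‖v 0‖ ^ 2) := by
  have hθ2 : θ ^ 2 ≤ 1 := pow_le_one₀ hθ0 hθ1
  have hbd : ∀ x, ‖S x‖ ≤ ‖x‖ := fun x => by simpa using S.le_of_opNorm_le hS x
  have hbd' : ∀ x, ‖(ContinuousLinearMap.adjoint S) x‖ ≤ ‖x‖ := fun x => by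
    simpa using (ContinuousLinearMap.adjoint S).le_of_opNorm_le
      ((LinearIsometryEquiv.norm_map _ S).trans_le hS) x
  induction t with
  | zero =>
    have h1 : ‖v 1‖ ≤ θ * (‖v 0‖ + ‖u 0‖) := by
      rw [hv 0, hw0, norm_smul, Real.norm_of_nonneg hθ0]
      gcongr
      exact (norm_add_le _ _).trans (by gcongr; exact hbd' _)
    have h2 : ‖u 1‖ ≤ θ * (‖u 0‖ + ‖v 1‖) := by
      rw [hu 0, norm_smul, Real.norm_of_nonneg hθ0]
      gcongr
      exact (norm_sub_le _ _).trans (by gcongr; exact hbd _)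
    have h3 : ‖v 1‖ ^ 2 ≤ θ ^ 2 * (2 * (‖u 0‖ ^ 2 + ‖v 0‖ ^ 2)) := by
      calc ‖v 1‖ ^ 2 ≤ (θ * (‖v 0‖ + ‖u 0‖)) ^ 2 := by gcongr
        _ = θ ^ 2 * (‖v 0‖ + ‖u 0‖) ^ 2 := by ring
        _ ≤ _ := by gcongr; nlinarith [sq_nonneg (‖v 0‖ - ‖u 0‖)]
    have h4 : ‖u 1‖ ^ 2 ≤ θ ^ 2 * (2 * (‖u 0‖ ^ 2 + ‖v 1‖ ^ 2)) := by
      calc ‖u 1‖ ^ 2 ≤ (θ * (‖u 0‖ + ‖v 1‖)) ^ 2 := by gcongr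
        _ = θ ^ 2 * (‖u 0‖ + ‖v 1‖) ^ 2 := by ring
        _ ≤ _ := by gcongr; nlinarith [sq_nonneg (‖u 0‖ - ‖v 1‖)]
    have h5 : ‖v 1‖ ^ 2 ≤ 2 * (‖u 0‖ ^ 2 + ‖v 0‖ ^ 2) :=
      h3.trans (mul_le_of_le_one_left (by positivity) hθ2)
    have h6 : ‖u 1‖ ^ 2 ≤ θ ^ 2 * (6 * (‖u 0‖ ^ 2 + ‖v 0‖ ^ 2)) := by
      refine h4.trans (mul_le_mul_of_nonneg_left ?_ (sq_nonneg θ))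
      linarith [sq_nonneg ‖v 0‖]
    rw [zero_add, pow_one]
    linarith
  | succ t ih =>
    have hwt : w (t + 1) = θ • (u (t + 1) - S (v (t + 1))) := by
      have h1 := hu t
      rw [smul_sub] at h1
      have h2 : θ • u t = u (t + 1) + θ • S (v (t + 1)) := by rw [h1]; abel
      rw [hw, smul_sub, h2]
      module
    set b₁ := v (t + 1) + θ • (ContinuousLinearMap.adjoint S) (u (t + 1) - S (v (t + 1))) with hb₁
    have hv' : v (t + 1 + 1) = θ • b₁ := by rw [hv, hwt, map_smul]
    have hu' : u (t + 1 + 1) = θ • (u (t + 1) - θ • S b₁) := by rw [hu, hv', map_smul]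
    have h := norm_sq_add_norm_sq_le_of_alternating_step hS hθ0 hθ1 hb₁
      (rfl : u (t + 1) - θ • S b₁ = _)
    rw [hv', hu', norm_smul, norm_smul, mul_pow, mul_pow, Real.norm_eq_abs, sq_abs, ← mul_add]
    calc _ ≤ θ ^ 2 * _ := mul_le_mul_of_nonneg_left (h.trans ih) (sq_nonneg θ)
      _ = _ := by ring

theorem pow_natFloor_add_one_le {β X : ℝ} (hβ : 0 ≤ β) (hX : 0 < X) :
    (β / (1 + β)) ^ (⌊(β + 1) * Real.log X⌋₊ + 1) ≤ 1 / X := by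
  have hβ1 : 0 < 1 + β := by linarith
  have h1 : β / (1 + β) ≤ Real.exp (-(1 / (1 + β))) := by
    have := Real.add_one_le_exp (-(1 / (1 + β)))
    have h2 : β / (1 + β) = -(1 / (1 + β)) + 1 := by field_simp; ring
    rwa [h2]
  calc _ ≤ Real.exp (-(1 / (1 + β))) ^ (⌊(β + 1) * Real.log X⌋₊ + 1) := by gcongr
    _ = Real.exp (-((⌊(β + 1) * Real.log X⌋₊ + 1 : ℝ) / (1 + β))) := by
      rw [← Real.exp_nat_mul]; congr 1; push_cast; ring
    _ ≤ Real.exp (-Real.log X) := by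
      apply Real.exp_le_exp.2
      rw [neg_le_neg_iff, le_div_iff₀ hβ1]
      have := (Nat.lt_floor_add_one ((β + 1) * Real.log X)).le
      linarith
    _ = 1 / X := by rw [Real.exp_neg, Real.exp_log hX, one_div]

theorem apfb_error_le {L μ m n s ρ C C₀ D : ℝ} {k : ℕ} (hLμ : 0 < L * μ) (hm0 : 0 < m)
    (hn0 : 0 ≤ n) (hs1 : 1 ≤ s) (hρ0 : 0 < ρ) (hρ1 : ρ < 1) (hC1 : 1 ≤ C) (hC₀0 : 0 ≤ C₀)
    (hD0 : 0 ≤ D) (hinit : D ≤ C₀ * (4 * C * (1 - ρ) ^ k + (1 - ρ) ^ (k + 1))) :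
    8 * ((n / (m + n)) ^ 2) ^ (⌊(n / m + 1) *
      Real.log (20 * C * (1 + s) * (L * μ + n ^ 2) / (L * μ * (1 - ρ)))⌋₊ + 2) * D ≤
      C₀ * L * μ * (1 - ρ) ^ (k + 1) / (2 * (1 + s) * (L * μ + n ^ 2)) := by
  have hmn : 0 < m + n := by linarith
  have hθ0 : 0 ≤ n / (m + n) := by positivity
  have hθ1 : n / (m + n) ≤ 1 := (div_le_one hmn).2 (by linarith)
  set X := 20 * C * (1 + s) * (L * μ + n ^ 2) / (L * μ * (1 - ρ)) with hX
  set N := ⌊(n / m + 1) * Real.log X⌋₊ with hN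
  have h1ρ : 0 < 1 - ρ := by linarith
  have hX20 : 20 ≤ X := by
    rw [hX, le_div_iff₀ (by positivity)]
    have h1 : L * μ * (1 - ρ) ≤ L * μ + n ^ 2 := by nlinarith [sq_nonneg n]
    have h2 : 1 ≤ C * (1 + s) := by nlinarith
    nlinarith [mul_le_mul h2 h1 (by positivity) (by positivity)]
  have hX0 : 0 < X := by linarith
  have hpow : (n / (m + n)) ^ (N + 1) ≤ 1 / X := by
    have := pow_natFloor_add_one_le (β := n / m) (by positivity) hX0
    rwa [show n / m / (1 + n / m) = n / (m + n) by field_simp] at this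
  have hpow2 : 8 * ((n / (m + n)) ^ 2) ^ (N + 1 + 1) ≤ 2 / X := by
    have h1 : ((n / (m + n)) ^ (N + 1)) ^ 2 ≤ (1 / X) ^ 2 := by gcongr
    have h2 : ((n / (m + n)) ^ 2) ^ (N + 1 + 1) ≤ ((n / (m + n)) ^ (N + 1)) ^ 2 := by
      rw [← pow_mul, ← pow_mul]
      exact pow_le_pow_of_le_one hθ0 hθ1 (by lia)
    have h3 : 8 * (1 / X) ^ 2 ≤ 2 / X := by
      rw [div_pow, one_pow, mul_one_div, div_le_div_iff₀ (by positivity) hX0]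
      nlinarith
    linarith
  have hinit' : D ≤ 5 * C * C₀ * (1 - ρ) ^ k := by
    refine hinit.trans ?_
    have h1 : 0 ≤ C₀ * (1 - ρ) ^ k := by positivity
    rw [pow_succ]
    nlinarith [mul_le_mul_of_nonneg_left (show 1 - ρ ≤ C by linarith) h1]
  calc _ ≤ 2 / X * (5 * C * C₀ * (1 - ρ) ^ k) := by gcongr
    _ = _ := by
      have : 0 < L * μ + n ^ 2 := by positivity
      rw [hX, pow_succ]
      field_simp
      ring

theorem norm_sub_smul_sq_add_norm_add_smul_sq (A : F →L[ℝ] E) (c : ℝ) (x : E) (y : F) :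
    ‖x - c • A y‖ ^ 2 + ‖y + c • (ContinuousLinearMap.adjoint A) x‖ ^ 2 =
      ‖x‖ ^ 2 + ‖y‖ ^ 2 + c ^ 2 * (‖A y‖ ^ 2 + ‖(ContinuousLinearMap.adjoint A) x‖ ^ 2) := by
  rw [norm_sub_sq_real, norm_add_sq_real, real_inner_smul_right, real_inner_smul_right,
    ContinuousLinearMap.adjoint_inner_right, real_inner_comm x (A y), norm_smul, norm_smul,
    mul_pow, mul_pow, Real.norm_eq_abs, sq_abs]
  ring

theorem norm_sq_add_norm_sq_le_sub_smul_add_smul (A : F →L[ℝ] E) (c : ℝ) (x : E) (y : F) :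
    ‖x‖ ^ 2 + ‖y‖ ^ 2 ≤
      ‖x - c • A y‖ ^ 2 + ‖y + c • (ContinuousLinearMap.adjoint A) x‖ ^ 2 := by
  rw [norm_sub_smul_sq_add_norm_add_smul_sq]
  have : 0 ≤ c ^ 2 * (‖A y‖ ^ 2 + ‖(ContinuousLinearMap.adjoint A) x‖ ^ 2) := by positivity
  linarith

/-- Distance from the current iterate to the saddle point of the quadratic subproblem built from
inexact proximal points. -/
theorem norm_sub_subproblem_saddle_sq_le [ProperSpace E] [ProperSpace F]
    {g : E → ℝ} {h : F → ℝ} {g' : E → E} {h' : F → F} {L μ m s α ε D : ℝ}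
    (hμ : 0 < μ) (hs1 : 1 ≤ s) (hLs : L = μ * s ^ 2) (hms : m = μ * s) (hmα : m * α = 1)
    (hgdiff : ∀ u, HasGradientAt g (g' u) u) (hhdiff : ∀ v, HasGradientAt h (h' v) v)
    (hgsmooth : ∀ u₁ u₂, ‖g' u₁ - g' u₂‖ ≤ L * ‖u₁ - u₂‖)
    (hhsmooth : ∀ v₁ v₂, ‖h' v₁ - h' v₂‖ ≤ L * ‖v₁ - v₂‖)
    (hgsc : ∀ u₁ u₂, g u₂ ≥ g u₁ + ⟪g' u₁, u₂ - u₁⟫ + μ / 2 * ‖u₂ - u₁‖ ^ 2)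
    (hhsc : ∀ v₁ v₂, h v₂ ≥ h v₁ + ⟪h' v₁, v₂ - v₁⟫ + μ / 2 * ‖v₂ - v₁‖ ^ 2)
    {A : F →L[ℝ] E} {xs : E} {ys : F}
    (hsaddle : ∀ x y, g xs + ⟪xs, A y⟫ - h y ≤ g xs + ⟪xs, A ys⟫ - h ys ∧
      g xs + ⟪xs, A ys⟫ - h ys ≤ g x + ⟪x, A ys⟫ - h ys)
    {xkm1 zk xtk xks : E} {ykm1 wk ytk yks : F}
    (hzk : zk = xkm1 - α • A ykm1)
    (hwk : wk = ykm1 + α • (ContinuousLinearMap.adjoint A) xkm1)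
    (hbound : ‖zk - (xs - α • A ys)‖ ^ 2 +
      ‖wk - (ys + α • (ContinuousLinearMap.adjoint A) xs)‖ ^ 2 ≤ D)
    (hxtk : ∀ u, g xtk + m / 2 * ‖xtk - zk‖ ^ 2 ≤ g u + m / 2 * ‖u - zk‖ ^ 2 + ε)
    (hytk : ∀ v, h ytk + m / 2 * ‖ytk - wk‖ ^ 2 ≤ h v + m / 2 * ‖v - wk‖ ^ 2 + ε)
    (hxks : xks + α • A yks = (2 : ℝ) • xtk - zk)
    (hyks : yks - α • (ContinuousLinearMap.adjoint A) xks = (2 : ℝ) • ytk - wk) :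
    ‖xkm1 - xks‖ ^ 2 + ‖ykm1 - yks‖ ^ 2 ≤ 4 * D + 4 * (4 * ε / μ) := by
  set B := ContinuousLinearMap.adjoint A with hB
  have hgs : g' xs = m • ((xs - α • A ys) - xs) := by
    have h1 := gradient_eq_of_forall_le ((hgdiff xs).add' (hasGradientAt_inner (A ys) xs))
      (fun u => by
        have := (hsaddle u ys).2
        rw [real_inner_comm (A ys) u, real_inner_comm (A ys) xs] at this
        linarith)
    rw [eq_neg_of_add_eq_zero_left h1, sub_sub_cancel_left, smul_neg, smul_smul, hmα, one_smul]
  have hhs : h' ys = m • ((ys + α • B xs) - ys) := by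
    have h1 := gradient_eq_of_forall_le ((hhdiff ys).add' (hasGradientAt_inner (-B xs) ys))
      (fun v => by
        have := (hsaddle xs v).1
        rw [inner_neg_left, inner_neg_left, hB, ContinuousLinearMap.adjoint_inner_left,
          ContinuousLinearMap.adjoint_inner_left]
        linarith)
    rw [eq_neg_of_add_eq_zero_left h1, neg_neg, add_sub_cancel_left, smul_smul, hmα, one_smul]
  have hx := norm_reflected_prox_sub_sq_le hμ hs1 hLs hms hgdiff hgsmooth hgsc hgs hxtk
  have hy := norm_reflected_prox_sub_sq_le hμ hs1 hLs hms hhdiff hhsmooth hhsc hhs hytk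
  have e1 : ((2 : ℝ) • xtk - zk) - ((2 : ℝ) • xs - (xs - α • A ys)) =
      (xks - xs) - (-α) • A (yks - ys) := by
    rw [← hxks, map_sub]; module
  have e2 : ((2 : ℝ) • ytk - wk) - ((2 : ℝ) • ys - (ys + α • B xs)) =
      (yks - ys) + (-α) • B (xks - xs) := by
    rw [← hyks, map_sub]; module
  rw [e1] at hx
  rw [e2] at hy
  have h1 := norm_sq_add_norm_sq_le_sub_smul_add_smul A (-α) (xks - xs) (yks - ys)
  have h2 := norm_sq_add_norm_sq_le_sub_smul_add_smul A α (xkm1 - xs) (ykm1 - ys)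
  have e3 : (xkm1 - xs) - α • A (ykm1 - ys) = zk - (xs - α • A ys) := by
    rw [hzk, map_sub]; module
  have e4 : (ykm1 - ys) + α • B (xkm1 - xs) = wk - (ys + α • B xs) := by
    rw [hwk, map_sub]; module
  rw [e3, e4] at h2
  have h4 : ‖xkm1 - xks‖ ^ 2 ≤ 2 * (‖xkm1 - xs‖ ^ 2 + ‖xks - xs‖ ^ 2) := by
    rw [← sub_sub_sub_cancel_right xkm1 xks xs]
    have := parallelogram_law_with_norm ℝ (xkm1 - xs) (xks - xs)
    nlinarith [sq_nonneg ‖xkm1 - xs + (xks - xs)‖]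
  have h5 : ‖ykm1 - yks‖ ^ 2 ≤ 2 * (‖ykm1 - ys‖ ^ 2 + ‖yks - ys‖ ^ 2) := by
    rw [← sub_sub_sub_cancel_right ykm1 yks ys]
    have := parallelogram_law_with_norm ℝ (ykm1 - ys) (yks - ys)
    nlinarith [sq_nonneg ‖ykm1 - ys + (yks - ys)‖]
  linarith

/-- Linear convergence of APFB on a bilinearly coupled quadratic saddle point problem. -/
theorem norm_sub_saddle_sq_le_of_apfb {m α : ℝ} (hm0 : 0 < m) (hmα : m * α = 1)
    {A : F →L[ℝ] E} {p xks : E} {q yks : F} (hxks : xks + α • A yks = p)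
    (hyks : yks - α • (ContinuousLinearMap.adjoint A) xks = q)
    {a at' : ℕ → E} {b : ℕ → F} (hat0 : at' 0 = a 0)
    (hatm : ∀ t, at' (t + 1) = a (t + 1) + (‖A‖ / (m + ‖A‖)) • (a (t + 1) - a t))
    (hbstep : ∀ t v, m / 2 * ‖b (t + 1) - q‖ ^ 2 + ‖A‖ / 2 *
        ‖b (t + 1) - b t - (1 / ‖A‖) • (ContinuousLinearMap.adjoint A) (at' t)‖ ^ 2 ≤
      m / 2 * ‖v - q‖ ^ 2 +
        ‖A‖ / 2 * ‖v - b t - (1 / ‖A‖) • (ContinuousLinearMap.adjoint A) (at' t)‖ ^ 2)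
    (hastep : ∀ t u, m / 2 * ‖a (t + 1) - p‖ ^ 2 +
        ‖A‖ / 2 * ‖a (t + 1) - a t + (1 / ‖A‖) • A (b (t + 1))‖ ^ 2 ≤
      m / 2 * ‖u - p‖ ^ 2 + ‖A‖ / 2 * ‖u - a t + (1 / ‖A‖) • A (b (t + 1))‖ ^ 2) (t : ℕ) :
    ‖a (t + 1) - xks‖ ^ 2 + ‖b (t + 1) - yks‖ ^ 2 ≤
      8 * ((‖A‖ / (m + ‖A‖)) ^ 2) ^ (t + 1) * (‖a 0 - xks‖ ^ 2 + ‖b 0 - yks‖ ^ 2) := by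
  set B := ContinuousLinearMap.adjoint A with hB
  set n := ‖A‖ with hn
  have hn0 : 0 ≤ n := norm_nonneg A
  have hmn : 0 < m + n := by linarith
  set S := n⁻¹ • A with hSdef
  have hnS : n • S = A := by
    by_cases h0 : n = 0
    · rw [h0, zero_smul, eq_comm, ← norm_eq_zero]; exact h0
    · rw [hSdef, smul_smul, mul_inv_cancel₀ h0, one_smul]
  have hnB : n • ContinuousLinearMap.adjoint S = B := by
    rw [hB, ← hnS]; simp
  have hS1 : ‖S‖ ≤ 1 := by
    rw [hSdef, norm_smul, norm_inv, Real.norm_of_nonneg hn0, ← hn]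
    exact inv_mul_le_one
  have hnS' : ∀ y, n • (1 / n) • A y = A y := fun y => by
    rw [one_div]
    exact congrArg (fun T : _ →L[ℝ] _ => T y) hnS
  have hnB' : ∀ x, n • (1 / n) • B x = B x := fun x => by
    have h1 : ContinuousLinearMap.adjoint S = n⁻¹ • B := by rw [hSdef]; simp [hB]
    rw [one_div]
    rw [h1] at hnB
    exact congrArg (fun T : _ →L[ℝ] _ => T x) hnB
  have hp : m • p = m • xks + A yks := by
    rw [← hxks, smul_add, smul_smul, hmα, one_smul]
  have hq : m • q = m • yks - B xks := by
    rw [← hyks, smul_sub, smul_smul, hmα, one_smul]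
  have hv : ∀ t, b (t + 1) - yks =
      (n / (m + n)) • (b t - yks + (ContinuousLinearMap.adjoint S) (at' t - xks)) := fun t => by
    have h1 := eq_of_forall_sum_sq_le (x := b (t + 1)) hm0 hn0
      (fun v => by simpa only [sub_sub] using hbstep t v)
    rw [hq, smul_add, hnB'] at h1
    have h2 : (m + n) • (b (t + 1) - yks) =
        n • (b t - yks + (ContinuousLinearMap.adjoint S) (at' t - xks)) := by
      have h3 : n • (ContinuousLinearMap.adjoint S) (at' t - xks) = B (at' t - xks) := by
        rw [← hnB]; rfl
      rw [smul_sub, h1, smul_add, h3, map_sub]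
      module
    rw [div_eq_inv_mul, mul_smul, ← h2, smul_smul, inv_mul_cancel₀ hmn.ne', one_smul]
  have hu : ∀ t, a (t + 1) - xks =
      (n / (m + n)) • (a t - xks - S (b (t + 1) - yks)) := fun t => by
    have h1 := eq_of_forall_sum_sq_le (x := a (t + 1)) (p := p) hm0 hn0
      (c := a t - (1 / n) • A (b (t + 1)))
      (fun u => by
        rw [← sub_add, ← sub_add]
        exact hastep t u)
    rw [hp, smul_sub, hnS'] at h1
    have h2 : (m + n) • (a (t + 1) - xks) = n • (a t - xks - S (b (t + 1) - yks)) := by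
      have h3 : n • S (b (t + 1) - yks) = A (b (t + 1) - yks) :=
        congrArg (fun T : _ →L[ℝ] _ => T (b (t + 1) - yks)) hnS
      rw [smul_sub, h1, smul_sub, h3, map_sub]
      module
    rw [div_eq_inv_mul, mul_smul, ← h2, smul_smul, inv_mul_cancel₀ hmn.ne', one_smul]
  exact norm_sq_add_norm_sq_le_of_extrapolated_iteration hS1 (by positivity)
    ((div_le_one hmn).2 (by linarith))
    (u := fun t => a t - xks) (w := fun t => at' t - xks) (v := fun t => b t - yks)
    (by simp only [hat0]) (fun t => by simp only [hatm]; module) hv hu t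

end

/-- inner APFB complexity in DIPPA.
In the DIPPA setting, fix `k ≥ 1` with `‖z_k − z*‖² + ‖w_k − w*‖² ≤ C·C₀·(1 − ρ)^k`,
let `x̃_k, ỹ_k` be `ε_k`-minimizers of `G_k, H_k` and `(x_k*, y_k*)` the saddle point of
the quadratic subproblem `f̃_k`. Then
`‖x_{k−1} − x_k*‖² + ‖y_{k−1} − y_k*‖² ≤ C₀(4C(1 − ρ)^k + (1 − ρ)^{k+1})`, and APFB run
on `f̃_k` from `(x_{k−1}, y_{k−1})` for
`K₂ = ⌊(‖A‖/√(Lμ) + 1) log(20C(1 + √κ)(Lμ + ‖A‖²)/(Lμ(1 − ρ)))⌋ + 2` steps produces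
`(x_k, y_k)` with `‖x_k − x_k*‖² + ‖y_k − y_k*‖² ≤ δ_k`. -/
theorem stmt_13 {dx dy : ℕ}
    (g : EuclideanSpace ℝ (Fin dx) → ℝ) (h : EuclideanSpace ℝ (Fin dy) → ℝ)
    (g' : EuclideanSpace ℝ (Fin dx) → EuclideanSpace ℝ (Fin dx))
    (h' : EuclideanSpace ℝ (Fin dy) → EuclideanSpace ℝ (Fin dy))
    (L μ : ℝ) (hμ : 0 < μ) (hμL : μ ≤ L)
    (hgdiff : ∀ u, HasGradientAt g (g' u) u) (hhdiff : ∀ v, HasGradientAt h (h' v) v)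
    (hgsmooth : ∀ u₁ u₂, ‖g' u₁ - g' u₂‖ ≤ L * ‖u₁ - u₂‖)
    (hhsmooth : ∀ v₁ v₂, ‖h' v₁ - h' v₂‖ ≤ L * ‖v₁ - v₂‖)
    (hgsc : ∀ u₁ u₂, g u₂ ≥ g u₁ + ⟪g' u₁, u₂ - u₁⟫ + μ / 2 * ‖u₂ - u₁‖ ^ 2)
    (hhsc : ∀ v₁ v₂, h v₂ ≥ h v₁ + ⟪h' v₁, v₂ - v₁⟫ + μ / 2 * ‖v₂ - v₁‖ ^ 2)
    (A : EuclideanSpace ℝ (Fin dy) →L[ℝ] EuclideanSpace ℝ (Fin dx))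
    (xs : EuclideanSpace ℝ (Fin dx)) (ys : EuclideanSpace ℝ (Fin dy))
    (hsaddle : ∀ (x : EuclideanSpace ℝ (Fin dx)) (y : EuclideanSpace ℝ (Fin dy)),
      g xs + ⟪xs, A y⟫ - h y ≤ g xs + ⟪xs, A ys⟫ - h ys ∧
      g xs + ⟪xs, A ys⟫ - h ys ≤ g x + ⟪x, A ys⟫ - h ys)
    (α κ ρ C₀ C : ℝ) (x₀ : EuclideanSpace ℝ (Fin dx)) (y₀ : EuclideanSpace ℝ (Fin dy))
    (hα : α = 1 / Real.sqrt (L * μ)) (hκ : κ = L / μ)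
    (hρ : ρ = 1 / (2 * Real.sqrt κ))
    (hC₀ : C₀ = ‖x₀ - xs‖ ^ 2 + ‖y₀ - ys‖ ^ 2)
    (hC : C = 4 * Real.sqrt κ + 1 + ‖A‖ ^ 2 / (L * μ))
    (k : ℕ) (hk : 1 ≤ k) (εk δk : ℝ)
    (hεk : εk = C₀ * μ / 16 * (1 - ρ) ^ (k + 1))
    (hδk : δk = C₀ * L * μ * (1 - ρ) ^ (k + 1) /
      (2 * (1 + Real.sqrt κ) * (L * μ + ‖A‖ ^ 2)))
    -- the current iterate `(x_{k−1}, y_{k−1})` and the associated `z_k`, `w_k`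
    (xkm1 : EuclideanSpace ℝ (Fin dx)) (ykm1 : EuclideanSpace ℝ (Fin dy))
    (zk : EuclideanSpace ℝ (Fin dx)) (wk : EuclideanSpace ℝ (Fin dy))
    (hzk : zk = xkm1 - α • A ykm1)
    (hwk : wk = ykm1 + α • (ContinuousLinearMap.adjoint A) xkm1)
    (hbound :
      ‖zk - (xs - α • A ys)‖ ^ 2 +
        ‖wk - (ys + α • (ContinuousLinearMap.adjoint A) xs)‖ ^ 2 ≤ C * C₀ * (1 - ρ) ^ k)
    -- `x̃_k` and `ỹ_k` are `ε_k`-minimizers of `G_k` and `H_k`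
    (xtk : EuclideanSpace ℝ (Fin dx)) (ytk : EuclideanSpace ℝ (Fin dy))
    (hxtk : ∀ u : EuclideanSpace ℝ (Fin dx),
      g xtk + 1 / (2 * α) * ‖xtk - zk‖ ^ 2 ≤ g u + 1 / (2 * α) * ‖u - zk‖ ^ 2 + εk)
    (hytk : ∀ v : EuclideanSpace ℝ (Fin dy),
      h ytk + 1 / (2 * α) * ‖ytk - wk‖ ^ 2 ≤ h v + 1 / (2 * α) * ‖v - wk‖ ^ 2 + εk)
    -- `(x_k*, y_k*)` is the saddle point of the quadratic subproblem `f̃_k`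
    (xks : EuclideanSpace ℝ (Fin dx)) (yks : EuclideanSpace ℝ (Fin dy))
    (hxks : xks + α • A yks = (2 : ℝ) • xtk - zk)
    (hyks : yks - α • (ContinuousLinearMap.adjoint A) xks = (2 : ℝ) • ytk - wk)
    -- the APFB iterates on `f̃_k`, whose two quadratics are `√(Lμ)`-strongly convex,
    -- so that `γ̃ = σ̃ = 1/‖A‖` and `θ̃ = ‖A‖/(√(Lμ) + ‖A‖)`
    (K₂ : ℕ)
    (hK₂ : K₂ = ⌊(‖A‖ / Real.sqrt (L * μ) + 1) *
      Real.log (20 * C * (1 + Real.sqrt κ) * (L * μ + ‖A‖ ^ 2) / (L * μ * (1 - ρ)))⌋₊ + 2)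
    (a at' : ℕ → EuclideanSpace ℝ (Fin dx)) (b : ℕ → EuclideanSpace ℝ (Fin dy))
    (ha0 : a 0 = xkm1) (hb0 : b 0 = ykm1) (hat0 : at' 0 = a 0)
    (hatm : ∀ t : ℕ, at' (t + 1) = a (t + 1) +
      (‖A‖ / (Real.sqrt (L * μ) + ‖A‖)) • (a (t + 1) - a t))
    (hbstep : ∀ (t : ℕ) (v : EuclideanSpace ℝ (Fin dy)),
      1 / (2 * α) * ‖b (t + 1) - ((2 : ℝ) • ytk - wk)‖ ^ 2 +
          ‖A‖ / 2 * ‖b (t + 1) - b t - (1 / ‖A‖) • (ContinuousLinearMap.adjoint A) (at' t)‖ ^ 2 ≤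
        1 / (2 * α) * ‖v - ((2 : ℝ) • ytk - wk)‖ ^ 2 +
          ‖A‖ / 2 * ‖v - b t - (1 / ‖A‖) • (ContinuousLinearMap.adjoint A) (at' t)‖ ^ 2)
    (hastep : ∀ (t : ℕ) (u : EuclideanSpace ℝ (Fin dx)),
      1 / (2 * α) * ‖a (t + 1) - ((2 : ℝ) • xtk - zk)‖ ^ 2 +
          ‖A‖ / 2 * ‖a (t + 1) - a t + (1 / ‖A‖) • A (b (t + 1))‖ ^ 2 ≤
        1 / (2 * α) * ‖u - ((2 : ℝ) • xtk - zk)‖ ^ 2 +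
          ‖A‖ / 2 * ‖u - a t + (1 / ‖A‖) • A (b (t + 1))‖ ^ 2) :
    ‖xkm1 - xks‖ ^ 2 + ‖ykm1 - yks‖ ^ 2 ≤
        C₀ * (4 * C * (1 - ρ) ^ k + (1 - ρ) ^ (k + 1)) ∧
    ‖a K₂ - xks‖ ^ 2 + ‖b K₂ - yks‖ ^ 2 ≤ δk := by
  have hL0 : 0 < L := hμ.trans_le hμL
  set s := Real.sqrt κ with hs
  set m := Real.sqrt (L * μ) with hm
  have hLμ : 0 < L * μ := mul_pos hL0 hμ
  have hm0 : 0 < m := Real.sqrt_pos.2 hLμ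
  have hs1 : 1 ≤ s := by
    rw [hs, Real.one_le_sqrt, hκ, one_le_div hμ]; exact hμL
  have hLs : L = μ * s ^ 2 := by
    rw [hs, Real.sq_sqrt (by rw [hκ]; positivity), hκ, mul_div_cancel₀ _ hμ.ne']
  have hms : m = μ * s := by
    rw [hm, hLs, show μ * s ^ 2 * μ = (μ * s) ^ 2 by ring]
    exact Real.sqrt_sq (by positivity)
  have hα2 : 1 / (2 * α) = m / 2 := by rw [hα]; field_simp
  have hmα : m * α = 1 := by rw [hα]; field_simp
  have hρ0 : 0 < ρ := by rw [hρ]; positivity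
  have hρ1 : ρ < 1 := by
    rw [hρ, div_lt_one (by positivity)]; linarith
  have hC₀0 : 0 ≤ C₀ := by rw [hC₀]; positivity
  have hC1 : 1 ≤ C := by
    have : 0 ≤ ‖A‖ ^ 2 / (L * μ) := by positivity
    rw [hC]; linarith
  rw [hα2] at hxtk hytk hbstep hastep
  have hinit : ‖xkm1 - xks‖ ^ 2 + ‖ykm1 - yks‖ ^ 2 ≤
      C₀ * (4 * C * (1 - ρ) ^ k + (1 - ρ) ^ (k + 1)) := by
    have h1 := norm_sub_subproblem_saddle_sq_le hμ hs1 hLs hms hmα hgdiff hhdiff hgsmooth hhsmooth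
      hgsc hhsc hsaddle hzk hwk hbound hxtk hytk hxks hyks
    have h2 : 4 * εk / μ = C₀ / 4 * (1 - ρ) ^ (k + 1) := by
      rw [hεk]; field_simp; ring
    rw [h2] at h1
    linarith
  refine ⟨hinit, ?_⟩
  have hconv := norm_sub_saddle_sq_le_of_apfb hm0 hmα hxks hyks hat0 hatm hbstep hastep
  rw [ha0, hb0] at hconv
  rw [hK₂, hδk]
  exact (hconv _).trans (apfb_error_le hLμ hm0 (norm_nonneg A) hs1 hρ0 hρ1 hC1 hC₀0
    (by positivity) hinit)
end
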